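/- arXiv:2105.01319 — 2 statements merged into one kernel-verified Lean document; each statement's English description precedes it below -/
import Mathlib

section
/- Let F be a field of characteristic p > 0 with F^{p−1} = F, let S ⊆ F be a nonempty set with pdeg(S) = k ∈ ℕ, and let {a_1, ..., a_k} be a p-basis of F^p(S). For r ∈ {1, ..., k} set t = k − r + 1; then ann ν^n_F(⋀^r dS) = [dy_1/y_1 ∧ ... ∧ dy_t/y_t | y_1, ..., y_t ∈ F^p(a_1, ..., a_k)^*] ∧ ν_{n−t}(F). For r > k, ann ν^n_F(⋀^r dS) = ν_n(F). -/
set_option synthInstance.maxHeartbeats 1000000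
set_option maxHeartbeats 1000000

open ExteriorAlgebra

noncomputable section Preamble

variable (F : Type) [Field F] (p : ℕ)

/-- The subfield `F^{p^t}(C)` of `F` generated by the `p^t`-th powers and the set `C`. -/
def pClosureT (t : ℕ) (C : Set F) : Subfield F :=
  Subfield.closure ((Set.range fun x : F => x ^ p ^ t) ∪ C)

/-- The subfield `F^p(C)` of `F` generated by the `p`-th powers and the set `C`. -/
def pClosure (C : Set F) : Subfield F := pClosureT F p 1 C

/-- The degree `[B(A) : B]` for a subfield `B` of `F` and a subset `A ⊆ F`. -/
def relDeg (B : Subfield F) (A : Set F) : ℕ :=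
  Module.finrank B (IntermediateField.adjoin B A)

/-- `pdeg A = k`, i.e. `[F^p(A) : F^p] = p ^ k`. -/
def pDegEq (A : Set F) (k : ℕ) : Prop :=
  relDeg F (pClosure F p ∅) A = p ^ k

/-- A finite family `a : Fin n → F` is `p`-independent if `[F^p(a₁,…,aₙ) : F^p] = pⁿ`. -/
def pIndep {n : ℕ} (a : Fin n → F) : Prop :=
  pDegEq F p (Set.range a) n

/-- The exterior algebra of the absolute differential forms of `F`; the spaces `Ωⁿ(F)`
are its graded pieces and the wedge product is its multiplication. -/
abbrev ExtOmega := ExteriorAlgebra F (Ω[F⁄ℤ])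

/-- The differential `d a` of an element `a : F`, viewed in the exterior algebra. -/
def dform (a : F) : ExtOmega F :=
  ExteriorAlgebra.ι F (KaehlerDifferential.D ℤ F a)

/-- The space `Ωⁿ(F)` of `n`-differential forms, as a submodule of the exterior algebra;
it is `0` for `n < 0`. -/
def OmegaPow (n : ℤ) : Submodule F (ExtOmega F) :=
  if 0 ≤ n then ⋀[F]^(n.toNat) (Ω[F⁄ℤ]) else ⊥

/-- The wedge product `d a₁ ∧ … ∧ d aₙ` of the differentials of a family. -/
def dwedge {n : ℕ} (a : Fin n → F) : ExtOmega F :=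
  (List.ofFn fun i => dform F (a i)).prod

/-- The annihilator `annΩ^n_F(U)` of a set `U` of differential forms. -/
def annOmega (n : ℕ) (U : Set (ExtOmega F)) : Submodule F (ExtOmega F) :=
  OmegaPow F n ⊓ ⨅ u ∈ U, LinearMap.ker (LinearMap.mulRight F u)

/-- The logarithmic differential form `(dx₁/x₁) ∧ … ∧ (dxₙ/xₙ)`. -/
def logForm {n : ℕ} (x : Fin n → F) : ExtOmega F :=
  (List.ofFn fun i => ExteriorAlgebra.ι F ((x i)⁻¹ • KaehlerDifferential.D ℤ F (x i))).prod

/-- The group `ν_n(F)`, additively generated by the logarithmic differential forms;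
it is `0` for `n < 0`. -/
def nuPow (n : ℤ) : AddSubgroup (ExtOmega F) :=
  if 0 ≤ n then
    AddSubgroup.closure
      {ω | ∃ x : Fin n.toNat → F, (∀ i, x i ≠ 0) ∧ ω = logForm F x}
  else ⊥

/-- The annihilator `ann ν^n_F(U)`. -/
def annNu (n : ℕ) (U : Set (ExtOmega F)) : AddSubgroup (ExtOmega F) :=
  (annOmega F n U).toAddSubgroup ⊓ nuPow F n

/-- `η ∧ W` for a form `η` and a subspace `W`. -/
def wedgeL (η : ExtOmega F) (W : Submodule F (ExtOmega F)) : Submodule F (ExtOmega F) :=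
  W.map (LinearMap.mulLeft F η)

/-- The set `dS₁ ∧ … ∧ dSᵣ` for sets `S₁, …, Sᵣ ⊆ F`. -/
def dSet {r : ℕ} (S : Fin r → Set F) : Set (ExtOmega F) :=
  {ω | ∃ s : Fin r → F, (∀ i, s i ∈ S i) ∧ ω = dwedge F s}

/-- The additive subgroup `[dy₁/y₁ ∧ … ∧ dy_t/y_t ∣ yᵢ ∈ K^*] ∧ ν_m(F)` of `Ωⁿ(F)`
(for `n = t + m`). -/
def logWedgeNu (K : Set F) (t : ℕ) (m : ℤ) : AddSubgroup (ExtOmega F) :=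
  AddSubgroup.closure
    {ω | ∃ y : Fin t → F, (∀ i, y i ∈ K ∧ y i ≠ 0) ∧
      ∃ χ ∈ nuPow F m, ω = logForm F y * χ}

variable (E : Type) [Field E] [Algebra F E]

/-- The restriction map `Ω(F) → Ω(E)` on exterior algebras of differential forms,
induced by the inclusion `F ⊆ E`; it sends `d a` to `d a` and `x dа₁ ∧ … ∧ daₙ` to
the corresponding form over `E`. -/
def resMap : ExtOmega F →+* ExtOmega E :=
  letI : Algebra F (ExtOmega E) :=
    ((algebraMap E (ExtOmega E)).comp (algebraMap F E)).toAlgebra'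
      (fun c x => Algebra.commutes (algebraMap F E c) x)
  (ExteriorAlgebra.lift F ⟨{
      toFun := fun w =>
        ExteriorAlgebra.ι E (KaehlerDifferential.map ℤ ℤ F E w)
      map_add' := fun x y => by simp
      map_smul' := fun c x => by
        simp only [map_smul, RingHom.id_apply]
        rw [← algebraMap_smul E c (KaehlerDifferential.map ℤ ℤ F E x), map_smul,
          Algebra.smul_def, Algebra.smul_def]
        rfl },
    fun m => ExteriorAlgebra.ι_sq_zero _⟩).toRingHom

/-- The kernel `Ωⁿ(E/F)` of the restriction map `Ωⁿ(F) → Ωⁿ(E)`. -/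
def OmegaKer (n : ℕ) : Set (ExtOmega F) :=
  {ω | ω ∈ OmegaPow F n ∧ resMap F E ω = 0}

/-- The kernel `ν_n(E/F) = Ωⁿ(E/F) ∩ ν_n(F)`. -/
def nuKer (n : ℕ) : Set (ExtOmega F) :=
  OmegaKer F E n ∩ (nuPow F n : Set (ExtOmega F))

end Preamble

/-- In a ring of prime characteristic, `(x - y) ^ (p - 1) = ∑ xⁱ yᵖ⁻¹⁻ⁱ` for commuting `x`, `y`. -/
theorem Commute.sub_pow_prime_sub_one {R : Type*} [Ring R] (p : ℕ) [hp : Fact p.Prime]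
    (hR : (p : R) = 0) {x y : R} (h : Commute x y) :
    (x - y) ^ (p - 1) = ∑ i ∈ Finset.range p, x ^ i * y ^ (p - 1 - i) := by
  have hp1 : 1 ≤ p := hp.out.one_lt.le
  have hch : ∀ k, k ≤ p - 1 → ((p - 1).choose k : R) = (-1) ^ k := by
    intro k
    induction k with
    | zero => simp
    | succ k ih =>
      intro hk
      have h1 : (p.choose (k + 1) : R) = 0 := by
        obtain ⟨m, hm⟩ := hp.out.dvd_choose_self (Nat.succ_ne_zero k) (by omega)
        rw [hm]; simp [hR]
      have h2 : p.choose (k + 1) = (p - 1).choose k + (p - 1).choose (k + 1) := by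
        conv_lhs => rw [← Nat.sub_add_cancel hp1]
        rw [Nat.choose_succ_succ]
      rw [h2, Nat.cast_add, ih (by omega)] at h1
      rw [pow_succ, eq_neg_of_add_eq_zero_right h1]; simp
  rw [sub_eq_add_neg, (h.neg_right).add_pow, Nat.sub_add_cancel hp1]
  refine Finset.sum_congr rfl fun i hi => ?_
  have hi' : i ≤ p - 1 := by have := Finset.mem_range.1 hi; omega
  rw [← Nat.choose_symm hi', hch _ (Nat.sub_le _ _), neg_pow y, mul_assoc, mul_assoc]
  congr 1
  rw [← ((Commute.neg_one_left y).pow_pow _ _).eq, ← mul_assoc,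
    ← (Commute.refl (-1 : R)).mul_pow]
  simp

theorem Polynomial.derivative_pow_eq_sum {R : Type*} [Ring R] (Z : Polynomial R) (n : ℕ) :
    Polynomial.derivative (Z ^ n) =
      ∑ i ∈ Finset.range n, Z ^ i * Polynomial.derivative Z * Z ^ (n - 1 - i) := by
  induction n with
  | zero => simp
  | succ n ih =>
    rw [pow_succ, Polynomial.derivative_mul, ih, Finset.sum_range_succ, Finset.sum_mul]
    simp only [Nat.add_sub_cancel, Nat.sub_self, pow_zero, mul_one, add_left_inj]
    refine Finset.sum_congr rfl fun i hi => ?_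
    have := Finset.mem_range.1 hi
    rw [mul_assoc _ _ Z, ← pow_succ]
    congr 2; omega

/-- Jacobson's formula for `(d + c) ^ p` when the iterated commutators of `d` with `c` commute
with `c`. -/
theorem jacobson_add_pow {R : Type*} [Ring R] (p : ℕ) [hp : Fact p.Prime]
    (hR : (p : R) = 0) (d : R) (c : ℕ → R) (hc : ∀ i, d * c i - c i * d = c (i + 1))
    (hcomm : ∀ i, Commute (c 0) (c i)) :
    (d + c 0) ^ p = d ^ p + c 0 ^ p + c (p - 1) := by
  open Polynomial in
  have hp0 := hp.out.pos
  have hp1 := hp.out.one_lt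
  set Z : Polynomial R := C d + X * C (c 0) with hZ
  have hRX : (p : Polynomial R) = 0 := by
    have := congrArg C hR
    simpa using this
  have hdZ : derivative Z = C (c 0) := by simp [hZ]
  have hder : derivative (Z ^ p) = C (c (p - 1)) := by
    rw [Polynomial.derivative_pow_eq_sum, hdZ]
    set l := LinearMap.mulLeft ℤ Z
    set r := LinearMap.mulRight ℤ Z
    have hlr : Commute l r := LinearMap.commute_mulLeft_right Z Z
    have hE : (p : Module.End ℤ (Polynomial R)) = 0 := by
      ext1 x
      simp [Module.End.natCast_apply, ← Nat.cast_smul_eq_nsmul (Polynomial R), hRX]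
    have h1 := Commute.sub_pow_prime_sub_one p hE hlr
    have h2 : ∀ n, ((l - r) ^ n) (C (c 0)) = C (c n) := by
      intro n
      induction n with
      | zero => simp
      | succ n ih =>
        rw [pow_succ', Module.End.mul_apply, ih, ← hc n]
        simp only [LinearMap.sub_apply, l, r, LinearMap.mulLeft_apply, LinearMap.mulRight_apply,
          hZ, add_mul, mul_add, C_sub, C_mul]
        rw [mul_assoc X, ← C_mul (a := c 0), (hcomm n).eq, ← mul_assoc (C (c n)) X, ← X_mul_C,
          mul_assoc X, ← C_mul (a := c n)]
        simp only [C_mul]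
        abel
    rw [← h2 (p - 1), h1, LinearMap.sum_apply]
    refine Finset.sum_congr rfl fun i _ => ?_
    rw [Module.End.mul_apply, LinearMap.pow_mulLeft, LinearMap.pow_mulRight]
    simp [mul_assoc]
  have hdeg : Z.natDegree ≤ 1 := by
    rw [hZ]
    refine natDegree_add_le_of_le (m := 1) (n := 1) (by simp) ?_
    rw [X_mul_C]; exact natDegree_C_mul_le _ _ |>.trans natDegree_X_le
  have hcz : (Z ^ p).coeff 0 = d ^ p := by
    have : (Z ^ p).coeff 0 = (constantCoeff Z) ^ p := by
      rw [← map_pow]; rfl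
    rw [this]; simp [hZ]
  have hcp : (Z ^ p).coeff p = c 0 ^ p := by
    have := coeff_pow_of_natDegree_le (m := p) hdeg
    rw [mul_one] at this
    rw [this]; simp [hZ, coeff_C]
  have hc1 : (Z ^ p).coeff 1 = c (p - 1) := by
    have := congrArg (fun q => q.coeff 0) hder
    simpa [coeff_derivative] using this
  have hcj : ∀ j, 2 ≤ j → j < p → (Z ^ p).coeff j = 0 := by
    intro j h2 hj
    have := congrArg (fun q => q.coeff (j - 1)) hder
    simp only [coeff_derivative] at this
    rw [coeff_C_of_ne_zero (by omega), Nat.sub_add_cancel (by omega)] at this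
    have h3 : (Z ^ p).coeff j * (j : R) = 0 := by
      rw [← this]; congr 1
      rw [← Nat.cast_add_one, Nat.sub_add_cancel (by omega)]
    have hcop : Nat.gcd j p = 1 := (Nat.coprime_of_lt_prime (by omega) hj hp.out).symm
    have hbez := congrArg (Int.cast : ℤ → R) (Nat.gcd_eq_gcd_ab j p)
    rw [hcop] at hbez
    push_cast at hbez
    rw [hR, zero_mul, add_zero] at hbez
    calc (Z ^ p).coeff j = (Z ^ p).coeff j * ((j : R) * ((Nat.gcdA j p : ℤ) : R)) := by
          rw [← hbez, mul_one]
      _ = 0 := by rw [← mul_assoc, h3, zero_mul]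
  have hnd : (Z ^ p).natDegree < p + 1 := by
    have := natDegree_pow_le_of_le p hdeg
    omega
  have hev : (d + c 0) ^ p = (Z ^ p).eval 1 := by
    let φ := eval₂RingHom' (RingHom.id R) (1 : R) (fun a => Commute.one_right a)
    have h1 : φ Z = d + c 0 := by simp [φ, hZ, eval₂RingHom']
    have h2 : ∀ q, φ q = q.eval 1 := fun q => rfl
    rw [← h2, map_pow, h1]
  rw [hev, eval_eq_sum_range' hnd, Finset.sum_range_succ, hcp]
  simp only [one_pow, mul_one]
  obtain ⟨m, rfl⟩ : ∃ m, p = m + 2 := ⟨p - 2, by omega⟩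
  rw [Finset.sum_range_succ', hcz, Finset.sum_range_succ', Finset.sum_eq_zero]
  · simp only [zero_add, hc1]; abel
  · intro i hi
    exact hcj _ (by omega) (by have := Finset.mem_range.1 hi; omega)

open Polynomial in
theorem descPochhammer_zmod_eq (p : ℕ) [hp : Fact p.Prime] :
    descPochhammer (ZMod p) p = X ^ p - X := by
  have hp1 := hp.out.one_lt
  have hm : (X ^ p - X : (ZMod p)[X]).Monic := monic_X_pow_sub (by simpa using hp1)
  have hd : (X ^ p - X : (ZMod p)[X]).natDegree = p := FiniteField.X_pow_card_sub_X_natDegree_eq _ hp1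
  have hmd : (descPochhammer (ZMod p) p).Monic := monic_descPochhammer _ _
  have hdd : (descPochhammer (ZMod p) p).natDegree = p := descPochhammer_natDegree _ _
  refine eq_of_degree_sub_lt_of_eval_finset_eq Finset.univ ?_ fun a _ => ?_
  · refine (degree_sub_lt_left ?_ hmd.ne_zero ?_).trans_le ?_
    · rw [degree_eq_natDegree hmd.ne_zero, degree_eq_natDegree hm.ne_zero, hd, hdd]
    · rw [hmd.leadingCoeff, hm.leadingCoeff]
    · rw [degree_eq_natDegree hmd.ne_zero, hdd]; simp
  · rw [descPochhammer_eval_eq_prod_range]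
    simp only [eval_sub, eval_pow, eval_X, ZMod.pow_card, sub_self]
    refine Finset.prod_eq_zero (Finset.mem_range.2 (ZMod.val_lt a)) ?_
    simp

open Polynomial in
/-- `∏_{j < p} (T - j) = T ^ p - T` in any ring of characteristic `p`. -/
theorem aeval_descPochhammer_prime {R : Type*} [Ring R] (p : ℕ) [hp : Fact p.Prime]
    (hR : (p : R) = 0) (T : R) : aeval T (descPochhammer ℤ p) = T ^ p - T := by
  have h : C (p : ℤ) ∣ descPochhammer ℤ p - (X ^ p - X) := by
    rw [C_dvd_iff_dvd_coeff]
    intro i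
    have := congrArg (fun q => q.coeff i) (descPochhammer_zmod_eq p)
    rw [← descPochhammer_map (Int.castRingHom (ZMod p))] at this
    rw [← ZMod.intCast_zmod_eq_zero_iff_dvd, coeff_sub, Int.cast_sub, sub_eq_zero]
    simp only [coeff_map, eq_intCast] at this
    rw [this]
    simp [coeff_X_pow, coeff_X]
  obtain ⟨Q, hQ⟩ := h
  rw [sub_eq_iff_eq_add.1 hQ]
  simp [hR]

section PClosure

variable {F : Type} [Field F] {p : ℕ}

theorem pow_mem_pClosure (C : Set F) (x : F) : x ^ p ∈ pClosure F p C :=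
  Subfield.subset_closure (Or.inl ⟨x, by simp⟩)

theorem subset_pClosure (C : Set F) : C ⊆ pClosure F p C :=
  fun _ hx => Subfield.subset_closure (Or.inr hx)

theorem pClosure_le {C : Set F} {K : Subfield F} (hpow : ∀ x : F, x ^ p ∈ K) (hC : C ⊆ K) :
    pClosure F p C ≤ K := by
  refine Subfield.closure_le.2 ?_
  rintro _ (⟨x, rfl⟩ | hx)
  · simpa using hpow x
  · exact hC hx

theorem pClosure_mono {C C' : Set F} (h : C ⊆ C') : pClosure F p C ≤ pClosure F p C' :=
  pClosure_le (pow_mem_pClosure _) (h.trans (subset_pClosure _))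

/-- The field `F^p(b₀, …, bₛ₋₁)`. -/
def genField (F : Type) [Field F] (p : ℕ) (b : ℕ → F) (s : ℕ) : Subfield F :=
  pClosure F p (b '' Set.Iio s)

theorem genField_mono (b : ℕ → F) {s t : ℕ} (h : s ≤ t) : genField F p b s ≤ genField F p b t :=
  pClosure_mono (Set.image_mono (Set.Iio_subset_Iio h))

theorem mem_genField (b : ℕ → F) {i s : ℕ} (h : i < s) : b i ∈ genField F p b s :=
  subset_pClosure _ ⟨i, h, rfl⟩

theorem pow_mem_genField (b : ℕ → F) (s : ℕ) (x : F) : x ^ p ∈ genField F p b s :=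
  pow_mem_pClosure _ x

theorem monomial_mem_genField (b : ℕ → F) (s : ℕ) (y : F) (m : ℕ → ℕ) :
    y ^ p * ∏ i ∈ Finset.range s, b i ^ m i ∈ genField F p b s :=
  mul_mem (pow_mem_genField b s y) (prod_mem fun _ hi =>
    pow_mem (mem_genField b (Finset.mem_range.1 hi)) _)

variable [CharP F p]

theorem Derivation.apply_pow_char (D : Derivation ℤ F F) (x : F) : D (x ^ p) = 0 := by
  rw [D.leibniz_pow, ← Nat.cast_smul_eq_nsmul F, CharP.cast_eq_zero, zero_smul]

variable [hp : Fact p.Prime]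

/-- Every element of `F^p(b₀, …, bₛ₋₁)` is a sum of monomials in the `bᵢ` with `p`-th powers as
coefficients. -/
theorem genField_induction {b : ℕ → F} {s : ℕ} {P : F → Prop}
    (mon : ∀ (y : F) (m : ℕ → ℕ), P (y ^ p * ∏ i ∈ Finset.range s, b i ^ m i))
    (add : ∀ x y, x ∈ genField F p b s → y ∈ genField F p b s → P x → P y → P (x + y))
    {x : F} (hx : x ∈ genField F p b s) : P x := by
  have hp0 : p ≠ 0 := hp.out.ne_zero
  let M : Submonoid F :=
    { carrier := {z | ∃ (y : F) (m : ℕ → ℕ), z = y ^ p * ∏ i ∈ Finset.range s, b i ^ m i}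
      one_mem' := ⟨1, 0, by simp⟩
      mul_mem' := by
        rintro _ _ ⟨y, m, rfl⟩ ⟨y', m', rfl⟩
        refine ⟨y * y', m + m', ?_⟩
        simp only [Pi.add_apply, pow_add, Finset.prod_mul_distrib, mul_pow]
        ring }
  have hneg : ∀ z ∈ M.subsemiringClosure, -z ∈ M.subsemiringClosure := by
    have h1 : (-1 : F) ∈ M.subsemiringClosure := by
      refine (Submonoid.subsemiringClosure_mem M).2 (AddSubmonoid.subset_closure ⟨-1, 0, ?_⟩)
      have : (-1 : F) ^ p = -1 := by rw [← frobenius_def, map_neg, map_one]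
      simp [this]
    intro z hz
    simpa using mul_mem h1 hz
  have hpow : ∀ z : F, z ^ p ∈ M.subsemiringClosure := fun z =>
    (Submonoid.subsemiringClosure_mem M).2 (AddSubmonoid.subset_closure ⟨z, 0, by simp⟩)
  let K : Subfield F :=
    { M.subsemiringClosure with
      neg_mem' := fun {z} hz => hneg z hz
      inv_mem' := by
        intro z hz
        by_cases h0 : z = 0
        · subst h0
          simp only [inv_zero]
          exact M.subsemiringClosure.zero_mem
        have : z⁻¹ = z ^ (p - 1) * (z⁻¹) ^ p := by
          rw [inv_pow, eq_mul_inv_iff_mul_eq₀ (pow_ne_zero _ h0), ← Nat.sub_add_cancel hp.out.one_lt.le,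
            pow_succ]
          field_simp
          simp
        rw [this]
        exact mul_mem (pow_mem (show z ∈ M.subsemiringClosure from hz) _) (hpow _) }
  have hK : genField F p b s ≤ K := by
    refine pClosure_le hpow ?_
    rintro _ ⟨i, hi, rfl⟩
    refine (Submonoid.subsemiringClosure_mem M).2
      (AddSubmonoid.subset_closure ⟨1, Pi.single i 1, ?_⟩)
    rw [Finset.prod_eq_single i]
    · simp
    · intro j _ hj; simp [Pi.single_eq_of_ne hj]
    · intro h; exact absurd (Finset.mem_range.2 hi) h
  have hx' : x ∈ AddSubmonoid.closure (M : Set F) :=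
    (Submonoid.subsemiringClosure_mem M).1 (hK hx)
  have : x ∈ genField F p b s ∧ P x := by
    induction hx' using AddSubmonoid.closure_induction with
    | mem z hz =>
      obtain ⟨y, m, rfl⟩ := hz
      exact ⟨monomial_mem_genField b s y m, mon y m⟩
    | zero =>
      have := mon 0 0
      simp only [ne_eq, hp0, not_false_eq_true, zero_pow, zero_mul] at this
      exact ⟨zero_mem _, this⟩
    | add z w hz hw h1 h2 =>
      have hm : ∀ z ∈ AddSubmonoid.closure (M : Set F), z ∈ genField F p b s ∧ P z := by
        intro z hz
        induction hz using AddSubmonoid.closure_induction with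
        | mem z hz =>
          obtain ⟨y, m, rfl⟩ := hz
          exact ⟨monomial_mem_genField b s y m, mon y m⟩
        | zero =>
          have := mon 0 0
          simp only [ne_eq, hp0, not_false_eq_true, zero_pow, zero_mul] at this
          exact ⟨zero_mem _, this⟩
        | add z w _ _ h1 h2 => exact ⟨add_mem h1.1 h2.1, add _ _ h1.1 h2.1 h1.2 h2.2⟩
      exact ⟨add_mem (hm z hz).1 (hm w hw).1,
        add _ _ (hm z hz).1 (hm w hw).1 (hm z hz).2 (hm w hw).2⟩
  exact this.2

end PClosure

/-- Derivations `Dᵢ` of `F` satisfying `Dᵢ bⱼ = δᵢⱼ bⱼ` for `i, j < N`. -/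
structure IsDualSystem {F : Type} [Field F] (N : ℕ) (b : ℕ → F) (D : ℕ → Derivation ℤ F F) :
    Prop where
  apply_self : ∀ i < N, D i (b i) = b i
  apply_ne : ∀ i j, j < N → i ≠ j → D i (b j) = 0
  ne_zero : ∀ i < N, b i ≠ 0
  eq_zero : ∀ i, N ≤ i → D i = 0

namespace IsDualSystem

variable {F : Type} [Field F] {p : ℕ} [hp : Fact p.Prime] [CharP F p] {N : ℕ} {b : ℕ → F}
  {D : ℕ → Derivation ℤ F F} (h : IsDualSystem N b D)
include h

omit hp in
theorem apply_monomial {s : ℕ} (hs : s ≤ N) (y : F) (m : ℕ → ℕ) (i : ℕ) :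
    D i (y ^ p * ∏ j ∈ Finset.range s, b j ^ m j) =
      ((if i < s then m i else 0 : ℕ) : F) * (y ^ p * ∏ j ∈ Finset.range s, b j ^ m j) := by
  rw [Derivation.leibniz, Derivation.apply_pow_char, smul_zero, add_zero, smul_eq_mul,
    mul_left_comm]
  congr 1
  induction s with
  | zero => simp
  | succ s ih =>
    rw [Finset.prod_range_succ, Derivation.leibniz, ih (by omega), Derivation.leibniz_pow]
    rcases lt_trichotomy i s with hi | rfl | hi
    · rw [h.apply_ne i s (by omega) (by omega)]
      simp [hi, show i < s + 1 by omega]; ring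
    · rw [h.apply_self i (by omega)]
      rcases Nat.eq_zero_or_pos (m i) with h0 | h0
      · simp [h0]
      · have : b i ^ m i = b i ^ (m i - 1) * b i := by
          rw [← pow_succ, Nat.sub_add_cancel h0]
        simp [this]; ring
    · rw [h.apply_ne i s (by omega) (by omega)]
      simp [show ¬ i < s by omega, show ¬ i < s + 1 by omega]

theorem apply_mem {s : ℕ} (hs : s ≤ N) (i : ℕ) {x : F} (hx : x ∈ genField F p b s) :
    D i x ∈ genField F p b s := by
  refine genField_induction (P := fun x => D i x ∈ genField F p b s) (fun y m => ?_)
    (fun x y _ _ hx hy => ?_) hx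
  · rw [h.apply_monomial hs]
    exact mul_mem (natCast_mem _ _) (monomial_mem_genField b s y m)
  · rw [map_add]; exact add_mem hx hy

theorem apply_eq_zero {s : ℕ} (hs : s ≤ N) {i : ℕ} (hi : s ≤ i) {x : F}
    (hx : x ∈ genField F p b s) : D i x = 0 := by
  refine genField_induction (P := fun x => D i x = 0) (fun y m => ?_)
    (fun x y _ _ hx hy => ?_) hx
  · rw [h.apply_monomial hs, if_neg (by omega)]; simp
  · rw [map_add, hx, hy, add_zero]

theorem apply_comm (i j : ℕ) {x : F} (hx : x ∈ genField F p b N) :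
    D i (D j x) = D j (D i x) := by
  refine genField_induction (P := fun x => D i (D j x) = D j (D i x)) (fun y m => ?_)
    (fun x y _ _ hx hy => ?_) hx
  · have key : ∀ (k l : ℕ), D k ((l : F) * (y ^ p * ∏ j ∈ Finset.range N, b j ^ m j)) =
        (l : F) * D k (y ^ p * ∏ j ∈ Finset.range N, b j ^ m j) := by
      intro k l
      rw [Derivation.leibniz]; simp
    rw [h.apply_monomial le_rfl, h.apply_monomial le_rfl, key, key, h.apply_monomial le_rfl,
      h.apply_monomial le_rfl]
    ring
  · simp only [map_add, hx, hy]


end IsDualSystem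

/-- The operator `1 - Dᵖ⁻¹`; on sums of eigenvectors of `D` with eigenvalues in the prime field it
is the projection to the kernel of `D`. -/
def zeroProj {F : Type} [Field F] (p : ℕ) (D : Derivation ℤ F F) : Module.End ℤ F :=
  1 - (D : F →ₗ[ℤ] F) ^ (p - 1)

section zeroProj

variable {F : Type} [Field F] {p : ℕ} (D : Derivation ℤ F F)

theorem zeroProj_apply (x : F) : zeroProj p D x = x - ((D : F →ₗ[ℤ] F) ^ (p - 1)) x := rfl

theorem Derivation.pow_mul_of_apply_eq_zero {a : F} (ha : D a = 0) (n : ℕ) (x : F) :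
    ((D : F →ₗ[ℤ] F) ^ n) (a * x) = a * ((D : F →ₗ[ℤ] F) ^ n) x := by
  induction n with
  | zero => simp
  | succ n ih => rw [pow_succ', Module.End.mul_apply, ih, Module.End.mul_apply]; simp [ha]

theorem Derivation.pow_apply_of_eigen {c x : F} (hc : D c = 0) (hx : D x = c * x) (n : ℕ) :
    ((D : F →ₗ[ℤ] F) ^ n) x = c ^ n * x := by
  induction n with
  | zero => simp
  | succ n ih => rw [pow_succ', Module.End.mul_apply, ih, pow_succ]
                 simp [hc, hx, Derivation.leibniz_pow]; ring

theorem zeroProj_mul {a : F} (ha : D a = 0) (x : F) :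
    zeroProj p D (a * x) = a * zeroProj p D x := by
  rw [zeroProj_apply, zeroProj_apply, D.pow_mul_of_apply_eq_zero ha, mul_sub]

theorem zeroProj_of_apply_eq_zero [hp : Fact p.Prime] {a : F} (ha : D a = 0) :
    zeroProj p D a = a := by
  obtain ⟨m, hm⟩ : ∃ m, p - 1 = m + 1 := ⟨p - 2, by have := hp.out.two_le; omega⟩
  rw [zeroProj_apply, hm, pow_succ, Module.End.mul_apply]
  simp [ha]

end zeroProj

namespace IsDualSystem

variable {F : Type} [Field F] {p : ℕ} [hp : Fact p.Prime] [CharP F p] {N : ℕ} {b : ℕ → F}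
  {D : ℕ → Derivation ℤ F F} (h : IsDualSystem N b D)
include h

theorem pow_char_apply (i : ℕ) {x : F} (hx : x ∈ genField F p b N) :
    ((D i : F →ₗ[ℤ] F) ^ p) x = D i x := by
  refine genField_induction (P := fun x => ((D i : F →ₗ[ℤ] F) ^ p) x = D i x) (fun y m => ?_)
    (fun x y _ _ hx hy => ?_) hx
  · rw [(D i).pow_apply_of_eigen (Derivation.map_natCast _ _) (h.apply_monomial le_rfl y m i),
      h.apply_monomial le_rfl]
    congr 1
    exact map_natCast (frobenius F p) _
  · simp only [map_add, hx, hy]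

theorem apply_zeroProj (i : ℕ) {x : F} (hx : x ∈ genField F p b N) :
    D i (zeroProj p (D i) x) = 0 := by
  have := h.pow_char_apply i hx
  rw [← Nat.sub_add_cancel hp.out.one_lt.le, pow_succ', Module.End.mul_apply] at this
  rw [zeroProj_apply, map_sub, sub_eq_zero]
  exact this.symm

theorem zeroProj_apply_self (i : ℕ) {x : F} (hx : x ∈ genField F p b N) :
    zeroProj p (D i) (D i x) = 0 := by
  have := h.pow_char_apply i hx
  rw [← Nat.sub_add_cancel hp.out.one_lt.le, pow_succ, Module.End.mul_apply] at this
  rw [zeroProj_apply, sub_eq_zero]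
  exact this.symm

theorem iterate_mem {s : ℕ} (hs : s ≤ N) (i n : ℕ) {x : F} (hx : x ∈ genField F p b s) :
    ((D i : F →ₗ[ℤ] F) ^ n) x ∈ genField F p b s := by
  induction n with
  | zero => simpa
  | succ n ih => rw [pow_succ', Module.End.mul_apply]; exact h.apply_mem hs i ih

theorem zeroProj_mem {s : ℕ} (hs : s ≤ N) (i : ℕ) {x : F} (hx : x ∈ genField F p b s) :
    zeroProj p (D i) x ∈ genField F p b s :=
  sub_mem hx (h.iterate_mem hs i _ hx)

theorem zeroProj_comm (i j : ℕ) {x : F} (hx : x ∈ genField F p b N) :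
    zeroProj p (D i) (D j x) = D j (zeroProj p (D i) x) := by
  have : ∀ n, ((D i : F →ₗ[ℤ] F) ^ n) (D j x) = D j (((D i : F →ₗ[ℤ] F) ^ n) x) := by
    intro n
    induction n with
    | zero => simp
    | succ n ih =>
      rw [pow_succ', Module.End.mul_apply, ih, Module.End.mul_apply]
      exact h.apply_comm i j (h.iterate_mem le_rfl i n hx)
  rw [zeroProj_apply, zeroProj_apply, this, map_sub]

theorem zeroProj_mem_genField {q : ℕ} (hq : q < N) {x : F} (hx : x ∈ genField F p b (q + 1)) :
    zeroProj p (D q) x ∈ genField F p b q := by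
  refine genField_induction (P := fun x => zeroProj p (D q) x ∈ genField F p b q)
    (fun y m => ?_) (fun x y _ _ hx hy => ?_) hx
  · rw [zeroProj_apply, (D q).pow_apply_of_eigen (Derivation.map_natCast _ _) (h.apply_monomial (by omega) y m q),
      if_pos (by omega)]
    by_cases hm : p ∣ m q
    · have h0 : (m q : F) = 0 := (CharP.cast_eq_zero_iff F p _).2 hm
      rw [h0, zero_pow (by have := hp.out.two_le; omega), zero_mul, sub_zero,
        Finset.prod_range_succ]
      obtain ⟨k, hk⟩ := hm
      refine mul_mem (pow_mem_genField b q y) (mul_mem (prod_mem fun i hi =>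
        Subfield.pow_mem _ (mem_genField b (Finset.mem_range.1 hi)) _) ?_)
      rw [hk, mul_comm, pow_mul]
      exact pow_mem_genField b q _
    · have h0 : (m q : F) ≠ 0 := fun h0 => hm ((CharP.cast_eq_zero_iff F p _).1 h0)
      have h1 : (m q : F) ^ (p - 1) = 1 := by
        apply mul_right_cancel₀ h0
        rw [← pow_succ, Nat.sub_add_cancel hp.out.one_lt.le, one_mul]
        exact map_natCast (frobenius F p) _
      rw [h1, one_mul, sub_self]
      exact zero_mem _
  · rw [map_add]; exact add_mem hx hy

theorem mem_genField_of_apply_eq_zero {s : ℕ} (hs : s ≤ N) {x : F} (hx : x ∈ genField F p b N)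
    (h0 : ∀ q, s ≤ q → q < N → D q x = 0) : x ∈ genField F p b s := by
  induction hs using Nat.decreasingInduction with
  | self => exact hx
  | of_succ q hq ih =>
    have h1 := ih fun q' hq' => h0 q' (by omega)
    rw [← zeroProj_of_apply_eq_zero (p := p) (D q) (h0 q le_rfl hq)]
    exact h.zeroProj_mem_genField hq h1

/-- If `γᵖ` is the part of `γ` killed by `D`, then `γ` is a logarithmic derivative. -/
theorem exists_logDeriv {q : ℕ} (hq : q < N) {γ : F} (hγ : γ ∈ genField F p b (q + 1))
    (hproj : zeroProj p (D q) γ = γ ^ p) :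
    ∃ y ∈ genField F p b (q + 1), y ≠ 0 ∧ D q y = γ * y := by
  set d : Module.End ℤ F := (D q : F →ₗ[ℤ] F) with hd
  set T : Module.End ℤ F := d + LinearMap.mulLeft ℤ (-γ) with hT
  have hTapp : ∀ x, T x = D q x - γ * x := by
    intro x; simp [hT, hd, sub_eq_add_neg]
  have hL := genField_mono (p := p) b (show q + 1 ≤ N by omega)
  have hR : (p : Module.End ℤ F) = 0 := by
    ext1 x
    simp [Module.End.natCast_apply, ← Nat.cast_smul_eq_nsmul F]
  have hTp : (T ^ p) 1 = T 1 := by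
    have hj := jacobson_add_pow p hR d (fun i => LinearMap.mulLeft ℤ ((d ^ i) (-γ)))
      (fun i => by
        ext1 x
        simp only [LinearMap.sub_apply, Module.End.mul_apply, LinearMap.mulLeft_apply,
          pow_succ' d i]
        simp only [hd, Derivation.coeFn_coe, Derivation.leibniz, smul_eq_mul]
        ring)
      (fun i => by
        ext1 x
        simp only [Module.End.mul_apply, LinearMap.mulLeft_apply]
        ring)
    simp only [pow_zero, Module.End.one_apply] at hj
    rw [hTapp, hj, LinearMap.add_apply, LinearMap.add_apply, LinearMap.pow_mulLeft,
      hd, h.pow_char_apply q (one_mem _)]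
    simp only [LinearMap.mulLeft_apply, map_neg, mul_one]
    have h1 : (-γ) ^ p = -γ ^ p := by
      rw [← frobenius_def, map_neg, frobenius_def]
    rw [h1, ← hproj, zeroProj_apply]
    ring
  have hTmem : ∀ x ∈ genField F p b (q + 1), T x ∈ genField F p b (q + 1) := fun x hx => by
    rw [hTapp]; exact sub_mem (h.apply_mem (by omega) q hx) (mul_mem hγ hx)
  let z : ℕ → F := fun n => Nat.rec 1 (fun j z => T z - (j : F) * z) n
  have hz0 : z 0 = 1 := rfl
  have hzs : ∀ j, z (j + 1) = T (z j) - (j : F) * z j := fun _ => rfl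
  have hzm : ∀ j, z j ∈ genField F p b (q + 1) := by
    intro j
    induction j with
    | zero => exact one_mem _
    | succ j ih => rw [hzs]; exact sub_mem (hTmem _ ih) (mul_mem (natCast_mem _ _) ih)
  have hzp : z p = 0 := by
    have hz : ∀ j, z j = (Polynomial.aeval T (descPochhammer ℤ j)) 1 := by
      intro j
      induction j with
      | zero => simp [hz0]
      | succ j ih =>
        rw [hzs, descPochhammer_succ_right, mul_comm (descPochhammer ℤ j), map_mul, Module.End.mul_apply, ← ih]
        simp [Module.End.natCast_apply]
    rw [hz, aeval_descPochhammer_prime p hR, LinearMap.sub_apply, hTp, sub_self]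
  obtain ⟨j, hj0, hj1⟩ : ∃ j, z j ≠ 0 ∧ z (j + 1) = 0 := by
    by_contra! hcon
    have : ∀ j, z j ≠ 0 := fun j => by
      induction j with
      | zero => rw [hz0]; exact one_ne_zero
      | succ j ih => exact hcon j ih
    exact this p hzp
  rw [hzs, hTapp] at hj1
  have hb := h.ne_zero q hq
  refine ⟨z j * ((b q) ^ j)⁻¹, mul_mem (hzm j) (inv_mem (Subfield.pow_mem _ (mem_genField b (by omega)) _)),
    mul_ne_zero hj0 (inv_ne_zero (pow_ne_zero _ hb)), ?_⟩
  have hbj : D q (b q ^ j) = (j : F) * b q ^ j := by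
    rw [Derivation.leibniz_pow, h.apply_self q hq]
    rcases j with _ | j
    · simp
    · simp [pow_succ]
  rw [Derivation.leibniz, Derivation.leibniz_inv, hbj]
  have h2 : D q (z j) = γ * z j + j * z j := by linear_combination hj1
  rw [h2]
  simp only [smul_eq_mul]
  field_simp
  ring

end IsDualSystem

/-- The polynomial `((x + y) ^ p - x ^ p - y ^ p) / p`. -/
def addPowDefect {F : Type} [Field F] (p : ℕ) (x y : F) : F :=
  ∑ k ∈ Finset.range (p - 1), ((p.choose (k + 1) / p : ℕ) : F) * (x ^ (k + 1) * y ^ (p - 1 - k))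

theorem Derivation.apply_addPowDefect {F : Type} [Field F] {p : ℕ} [hp : Fact p.Prime]
    (D : Derivation ℤ F F) (x y : F) :
    D (addPowDefect p x y) =
      (x + y) ^ (p - 1) * D (x + y) - x ^ (p - 1) * D x - y ^ (p - 1) * D y := by
  obtain ⟨m, rfl⟩ : ∃ m, p = m + 1 := ⟨p - 1, by have := hp.out.pos; omega⟩
  simp only [addPowDefect, Nat.add_sub_cancel]
  have hterm : ∀ k ∈ Finset.range m, D ((((m + 1).choose (k + 1) / (m + 1) : ℕ) : F) *
      (x ^ (k + 1) * y ^ (m - k))) =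
      (m.choose k : F) * x ^ k * y ^ (m - k) * D x +
        (m.choose (k + 1) : F) * x ^ (k + 1) * y ^ (m - (k + 1)) * D y := by
    intro k hk
    have hk := Finset.mem_range.1 hk
    obtain ⟨e, he⟩ := hp.out.dvd_choose_self (Nat.succ_ne_zero k) (by omega)
    rw [he, Nat.mul_div_cancel_left _ hp.out.pos]
    have h1 : m.choose k = e * (k + 1) := by
      have := Nat.add_one_mul_choose_eq m k
      rw [he, mul_assoc] at this
      exact Nat.eq_of_mul_eq_mul_left hp.out.pos this
    have h2 : m.choose (k + 1) = e * (m - k) := by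
      have h3 := Nat.add_one_mul_choose_eq m (k + 1)
      rw [Nat.choose_succ_right_eq, he, mul_assoc] at h3
      have := Nat.eq_of_mul_eq_mul_left hp.out.pos h3
      rw [this]; congr 1; omega
    obtain ⟨l, rfl⟩ : ∃ l, m = k + l + 1 := ⟨m - k - 1, by omega⟩
    rw [h1, h2, show k + l + 1 - k = l + 1 by omega, show k + l + 1 - (k + 1) = l by omega]
    simp only [Derivation.leibniz, Derivation.leibniz_pow, Derivation.map_natCast, smul_eq_mul,
      nsmul_eq_mul, Nat.add_sub_cancel]
    push_cast
    ring
  rw [map_sum, Finset.sum_congr rfl hterm, Finset.sum_add_distrib, ← Finset.sum_mul,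
    ← Finset.sum_mul, map_add, add_pow]
  have e1 := Finset.sum_range_succ (fun k => x ^ k * y ^ (m - k) * (m.choose k : F)) m
  have e2 := Finset.sum_range_succ' (fun k => x ^ k * y ^ (m - k) * (m.choose k : F)) m
  have c1 : ∑ k ∈ Finset.range m, (m.choose k : F) * x ^ k * y ^ (m - k) =
      ∑ k ∈ Finset.range m, x ^ k * y ^ (m - k) * (m.choose k : F) :=
    Finset.sum_congr rfl fun _ _ => by ring
  have c2 : ∑ k ∈ Finset.range m, (m.choose (k + 1) : F) * x ^ (k + 1) * y ^ (m - (k + 1)) =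
      ∑ k ∈ Finset.range m, x ^ (k + 1) * y ^ (m - (k + 1)) * (m.choose (k + 1) : F) :=
    Finset.sum_congr rfl fun _ _ => by ring
  rw [c1, c2, mul_add]
  conv_rhs => rw [e1]
  rw [e1] at e2
  simp only [Nat.sub_self, pow_zero, Nat.choose_self, Nat.choose_zero_right, Nat.sub_zero] at e2 ⊢
  linear_combination (-D y) * e2

theorem exists_natCast_eq_of_pow_eq {F : Type} [Field F] {p : ℕ} [hp : Fact p.Prime] [CharP F p]
    {c : F} (hc : c ^ p = c) : ∃ z : ℕ, c = z := by
  have h := aeval_descPochhammer_prime (R := F) p (CharP.cast_eq_zero F p) c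
  rw [hc, sub_self, ← Polynomial.eval_map_algebraMap, descPochhammer_map,
    descPochhammer_eval_eq_prod_range, Finset.prod_eq_zero_iff] at h
  obtain ⟨z, -, hz⟩ := h
  exact ⟨z, sub_eq_zero.1 hz⟩

namespace IsDualSystem

variable {F : Type} [Field F] {p : ℕ} [hp : Fact p.Prime] [CharP F p] {N : ℕ} {b : ℕ → F}
  {D : ℕ → Derivation ℤ F F} (h : IsDualSystem N b D)
include h

theorem exists_pow_mul_sub_eq {x : F} (hx : x ∈ genField F p b N) :
    ∃ g ∈ genField F p b N, ∀ i, x ^ (p - 1) * D i x - (D i x) ^ p = D i g := by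
  refine genField_induction (P := fun x => ∃ g ∈ genField F p b N, ∀ i,
    x ^ (p - 1) * D i x - (D i x) ^ p = D i g) (fun y m => ⟨0, zero_mem _, fun i => ?_⟩)
    (fun x y hx hy ihx ihy => ?_) hx
  · rw [h.apply_monomial le_rfl, map_zero]
    generalize y ^ p * ∏ j ∈ Finset.range N, b j ^ m j = z
    rw [mul_pow, mul_left_comm, ← pow_succ, Nat.sub_add_cancel hp.out.one_lt.le, ← sub_mul]
    rw [show ((_ : ℕ) : F) ^ p = _ from map_natCast (frobenius F p) _, sub_self, zero_mul]
  · obtain ⟨g, hg, ihg⟩ := ihx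
    obtain ⟨g', hg', ihg'⟩ := ihy
    refine ⟨g + g' + addPowDefect p x y, add_mem (add_mem hg hg') (sum_mem fun k _ =>
      mul_mem (natCast_mem _ _) (mul_mem (pow_mem hx _) (pow_mem hy _))), fun i => ?_⟩
    rw [map_add (D i) (g + g'), map_add (D i) g, ← ihg, ← ihg', Derivation.apply_addPowDefect,
      map_add, add_pow_char (D i x)]
    ring

/-- `dlog x` agrees with its Frobenius twist modulo exact forms. -/
theorem exists_logDeriv_sub_eq {x : F} (hx : x ∈ genField F p b N) (h0 : x ≠ 0) :
    ∃ g ∈ genField F p b N, ∀ i, x⁻¹ * D i x - (x⁻¹ * D i x) ^ p = D i g := by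
  obtain ⟨g, hg, hgi⟩ := h.exists_pow_mul_sub_eq hx
  refine ⟨(x⁻¹) ^ p * g, mul_mem (pow_mem_genField _ _ _) hg, fun i => ?_⟩
  rw [Derivation.leibniz, Derivation.apply_pow_char, smul_zero, add_zero, smul_eq_mul, ← hgi,
    mul_sub, mul_pow]
  congr 1
  have : (x⁻¹) ^ p * x ^ (p - 1) = x⁻¹ := by
    rw [inv_pow]
    field_simp
    rw [← pow_succ, Nat.sub_add_cancel hp.out.one_lt.le]
  rw [← mul_assoc, this]

theorem eq_zero_of_pow_eq_sum (I : Finset ℕ) {c : F} {g : ℕ → F}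
    (hg : ∀ i, g i ∈ genField F p b N) (hc : c ^ p = ∑ j ∈ I, D j (g j)) : c = 0 := by
  induction I using Finset.induction_on generalizing g with
  | empty => exact pow_eq_zero_iff hp.out.ne_zero |>.1 (by simpa using hc)
  | insert q I hq ih =>
    have := congrArg (zeroProj p (D q)) hc
    rw [zeroProj_of_apply_eq_zero _ ((D q).apply_pow_char c), Finset.sum_insert hq, map_add,
      h.zeroProj_apply_self q (hg q), zero_add, map_sum] at this
    refine ih (g := fun j => zeroProj p (D q) (g j)) (fun i => h.zeroProj_mem le_rfl q (hg i)) ?_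
    rw [this]
    exact Finset.sum_congr rfl fun j _ => h.zeroProj_comm q j (hg j)

/-- Factorization of the leading coefficient of a form fixed by the Cartier operator. -/
theorem exists_factorization (hF : ∀ x : F, ∃ y : F, y ^ (p - 1) = x) (I : Finset ℕ)
    (hI : ∀ i ∈ I, i < N) {c : F} (hcL : c ∈ genField F p b N) (hc0 : c ≠ 0)
    (hcl : ∀ q < N, q ∉ I → ∃ f : ℕ → F, (∀ i, f i ∈ genField F p b N) ∧
      D q c = ∑ j ∈ I with q < j, D j (f j))
    (hfix : ∃ g : ℕ → F, (∀ i, g i ∈ genField F p b N) ∧ c - c ^ p = ∑ j ∈ I, D j (g j)) :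
    ∃ (γ : ℕ → F) (z : ℤ), (∀ i ∈ I, γ i ∈ genField F p b (i + 1) ∧
      zeroProj p (D i) (γ i) = γ i ^ p) ∧ c = z * ∏ i ∈ I, γ i := by
  have hp1 := hp.out.one_lt
  induction I using Finset.induction_on_max generalizing c with
  | empty =>
    obtain ⟨g, -, hg⟩ := hfix
    rw [Finset.sum_empty, sub_eq_zero] at hg
    obtain ⟨z, rfl⟩ := exists_natCast_eq_of_pow_eq hg.symm
    exact ⟨0, z, by simp, by simp⟩
  | insert q I hqI ih =>
    have hqN : q < N := hI q (Finset.mem_insert_self _ _)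
    have hqn : q ∉ I := fun hq => (hqI q hq).false
    have hcq : c ∈ genField F p b (q + 1) := by
      refine h.mem_genField_of_apply_eq_zero hqN hcL fun q' hq' hq'N => ?_
      obtain ⟨f, -, hf⟩ := hcl q' hq'N (by
        rw [Finset.mem_insert]
        rintro (rfl | h')
        · omega
        · have := hqI _ h'; omega)
      rw [hf]
      refine Finset.sum_eq_zero fun j hj => ?_
      rw [Finset.mem_filter, Finset.mem_insert] at hj
      rcases hj with ⟨rfl | h', h''⟩
      · omega
      · have := hqI _ h'; omega
    set c₀ := zeroProj p (D q) c with hc₀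
    have hc₀q : c₀ ∈ genField F p b q := h.zeroProj_mem_genField hqN hcq
    have hDc₀ : D q c₀ = 0 := h.apply_zeroProj q hcL
    obtain ⟨g, hg, hgc⟩ := hfix
    have hfix₀ : c₀ - c ^ p = ∑ j ∈ I, D j (zeroProj p (D q) (g j)) := by
      have := congrArg (zeroProj p (D q)) hgc
      rw [map_sub, zeroProj_of_apply_eq_zero _ ((D q).apply_pow_char c), Finset.sum_insert hqn,
        map_add, h.zeroProj_apply_self q (hg q), zero_add, map_sum] at this
      rw [this]
      exact Finset.sum_congr rfl fun j _ => h.zeroProj_comm q j (hg j)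
    have hc₀0 : c₀ ≠ 0 := by
      intro h0
      rw [h0, zero_sub, neg_eq_iff_eq_neg, ← Finset.sum_neg_distrib] at hfix₀
      refine hc0 (h.eq_zero_of_pow_eq_sum I (g := fun j => -zeroProj p (D q) (g j))
        (fun i => neg_mem (h.zeroProj_mem le_rfl q (hg i))) ?_)
      simpa using hfix₀
    obtain ⟨μ, hμ⟩ := hF (c / c₀)
    have hμ0 : μ ≠ 0 := by
      rintro rfl
      rw [zero_pow (by omega)] at hμ
      exact div_ne_zero hc0 hc₀0 hμ.symm
    have hu : c = μ ^ (p - 1) * c₀ := by rw [hμ]; field_simp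
    have hμp : μ ^ p = μ ^ (p - 1) * μ := by rw [← pow_succ, Nat.sub_add_cancel hp1.le]
    -- the factor `c / (c₀ μ ^ p)` belonging to `q`, and the remaining factor `c₀ μ ^ p`
    have hDμ : ∀ j, D j (μ ^ p) = 0 := fun j => (D j).apply_pow_char μ
    have hDμi : ∀ j, D j ((μ⁻¹) ^ p) = 0 := fun j => (D j).apply_pow_char μ⁻¹
    have hDci : D q c₀⁻¹ = 0 := by rw [Derivation.leibniz_inv, hDc₀]; simp
    set c' := c₀ * μ ^ p with hc'
    set δ := (μ⁻¹) ^ p * (c₀⁻¹ * c) with hδ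
    have hcδ : c = c' * δ := by rw [hc', hδ, inv_pow]; field_simp
    have hδmem : δ ∈ genField F p b (q + 1) :=
      mul_mem (pow_mem_genField _ _ _) (mul_mem (inv_mem (genField_mono b q.le_succ hc₀q)) hcq)
    have hδp : zeroProj p (D q) δ = δ ^ p := by
      rw [hδ, zeroProj_mul _ (hDμi q), zeroProj_mul _ hDci, ← hc₀, inv_mul_cancel₀ hc₀0, hu]
      have h1 : (μ⁻¹) ^ p * (c₀⁻¹ * (μ ^ (p - 1) * c₀)) = μ⁻¹ := by
        rw [inv_pow, hμp]; field_simp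
      rw [h1, mul_one]
    have hqNle : genField F p b q ≤ genField F p b N := genField_mono b hqN.le
    have hc'L : c' ∈ genField F p b N := mul_mem (hqNle hc₀q) (pow_mem_genField _ _ _)
    obtain ⟨γ, z, hγ, hz⟩ := ih (fun i hi => hI i (Finset.mem_insert_of_mem hi)) hc'L
      (mul_ne_zero hc₀0 (pow_ne_zero _ hμ0)) (by
        intro q' hq'N hq'I
        have hmul : D q' c' = μ ^ p * D q' c₀ := by
          rw [hc', Derivation.leibniz, hDμ, smul_zero, zero_add, smul_eq_mul]
        by_cases hqq : q' = q
        · subst hqq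
          refine ⟨0, fun _ => zero_mem _, ?_⟩
          rw [hmul, hDc₀]; simp
        obtain ⟨f, hf, hfc⟩ := hcl q' hq'N (by simp [hqq, hq'I])
        refine ⟨fun j => μ ^ p * zeroProj p (D q) (f j), fun i =>
          mul_mem (pow_mem_genField _ _ _) (h.zeroProj_mem le_rfl q (hf i)), ?_⟩
        rw [hmul, hc₀, ← h.zeroProj_comm q q' hcL, hfc, map_sum, Finset.filter_insert]
        have hs : ∑ j ∈ I with q' < j, D j (μ ^ p * zeroProj p (D q) (f j)) =
            μ ^ p * ∑ j ∈ I with q' < j, zeroProj p (D q) (D j (f j)) := by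
          rw [Finset.mul_sum]
          refine Finset.sum_congr rfl fun j _ => ?_
          rw [Derivation.leibniz, hDμ, smul_zero, add_zero, smul_eq_mul,
            h.zeroProj_comm q j (hf j)]
        rw [hs]
        split_ifs
        · rw [Finset.sum_insert (by simp [hqn]), h.zeroProj_apply_self q (hf q), zero_add]
        · rfl)
      ⟨fun j => μ ^ p * zeroProj p (D q) (g j), fun i =>
          mul_mem (pow_mem_genField _ _ _) (h.zeroProj_mem le_rfl q (hg i)), by
        have hs : ∑ j ∈ I, D j (μ ^ p * zeroProj p (D q) (g j)) =
            μ ^ p * ∑ j ∈ I, D j (zeroProj p (D q) (g j)) := by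
          rw [Finset.mul_sum]
          refine Finset.sum_congr rfl fun j _ => ?_
          rw [Derivation.leibniz, hDμ, smul_zero, add_zero, smul_eq_mul]
        rw [hs, ← hfix₀]
        have h2 : c' ^ p = μ ^ p * c ^ p := by
          rw [hc', hu, mul_pow, mul_pow]
          nth_rewrite 1 [hμp]
          ring
        rw [h2, hc']; ring⟩
    refine ⟨Function.update γ q δ, z, ?_, ?_⟩
    · intro i hi
      rcases Finset.mem_insert.1 hi with rfl | hi
      · simpa using ⟨hδmem, hδp⟩
      · rw [Function.update_of_ne (hqI i hi).ne]; exact hγ i hi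
    · rw [Finset.prod_insert hqn, Function.update_self, hcδ, hz,
        Finset.prod_congr rfl fun i hi => Function.update_of_ne (hqI i hi).ne δ γ]
      ring

end IsDualSystem

section Fock

variable {F : Type} [Field F]

/-- The sign obtained by moving `j` to its place in the increasing enumeration of `K`. -/
def wedgeSign (F : Type) [Field F] (j : ℕ) (K : Finset ℕ) : F := (-1) ^ (K.filter (· < j)).card

theorem wedgeSign_ne_zero (j : ℕ) (K : Finset ℕ) : wedgeSign F j K ≠ 0 :=
  pow_ne_zero _ (neg_ne_zero.2 one_ne_zero)

theorem wedgeSign_mul_self (j : ℕ) (K : Finset ℕ) : wedgeSign F j K * wedgeSign F j K = 1 := by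
  rw [wedgeSign, ← mul_pow]; simp

theorem wedgeSign_pow (p : ℕ) [Fact p.Prime] [CharP F p] (j : ℕ) (K : Finset ℕ) :
    wedgeSign F j K ^ p = wedgeSign F j K := by
  have : (-1 : F) ^ p = -1 := by rw [← frobenius_def, map_neg, map_one]
  rw [wedgeSign, ← pow_mul, mul_comm, pow_mul, this]

theorem wedgeSign_mem (L : Subfield F) (j : ℕ) (K : Finset ℕ) : wedgeSign F j K ∈ L :=
  pow_mem (neg_mem (one_mem _)) _

theorem Derivation.apply_wedgeSign_mul (D : Derivation ℤ F F) (j : ℕ) (K : Finset ℕ) (x : F) :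
    D (wedgeSign F j K * x) = wedgeSign F j K * D x := by
  have : D (wedgeSign F j K) = 0 := by
    rw [wedgeSign, Derivation.leibniz_pow]; simp
  rw [Derivation.leibniz, this]; simp

theorem wedgeSign_erase_of_lt {i j : ℕ} (h : i < j) (K : Finset ℕ) :
    wedgeSign F i (K.erase j) = wedgeSign F i K := by
  rw [wedgeSign, wedgeSign, Finset.filter_erase, Finset.erase_eq_of_notMem]
  simp; omega

theorem wedgeSign_erase_of_gt {i j : ℕ} (h : i < j) {K : Finset ℕ} (hi : i ∈ K) :
    wedgeSign F j (K.erase i) = -wedgeSign F j K := by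
  have hi' : i ∈ K.filter (· < j) := by simp [h, hi]
  rw [wedgeSign, wedgeSign, Finset.filter_erase, ← Finset.card_erase_add_one hi', pow_succ]
  simp

theorem wedgeSign_eq_one {i : ℕ} {K : Finset ℕ} (h : ∀ j ∈ K, i ≤ j) : wedgeSign F i K = 1 := by
  rw [wedgeSign, Finset.filter_false_of_mem fun j hj => by have := h j hj; omega]
  simp

/-- The creation operator `e_j ∧ -` on the exterior algebra on `e₀, e₁, …`, whose elements are
described by their coefficients. -/
def creation (F : Type) [Field F] (j : ℕ) : Module.End F (Finset ℕ → F) where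
  toFun f K := if j ∈ K then wedgeSign F j K * f (K.erase j) else 0
  map_add' f g := by
    ext K
    by_cases h : j ∈ K <;> simp [h, mul_add]
  map_smul' a f := by
    ext K
    by_cases h : j ∈ K <;> simp [h, mul_left_comm]

theorem creation_apply (j : ℕ) (f : Finset ℕ → F) (K : Finset ℕ) :
    creation F j f K = if j ∈ K then wedgeSign F j K * f (K.erase j) else 0 := rfl

theorem creation_mul_self (j : ℕ) : creation F j * creation F j = 0 := by
  refine LinearMap.ext fun f => funext fun K => ?_
  simp [creation_apply]

theorem creation_mul_comm_of_lt {i j : ℕ} (h : i < j) :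
    creation F i * creation F j = -(creation F j * creation F i) := by
  refine LinearMap.ext fun f => funext fun K => ?_
  simp only [Module.End.mul_apply, LinearMap.neg_apply, Pi.neg_apply, creation_apply,
    Finset.mem_erase]
  by_cases hi : i ∈ K <;> by_cases hj : j ∈ K
  · simp only [hi, hj, h.ne, h.ne', and_true, ne_eq, not_false_eq_true, if_true]
    rw [wedgeSign_erase_of_gt h hi, wedgeSign_erase_of_lt h, Finset.erase_right_comm]
    ring
  all_goals simp [hi, hj]

theorem creation_mul_comm (i j : ℕ) :
    creation F i * creation F j = -(creation F j * creation F i) := by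
  rcases lt_trichotomy i j with h | rfl | h
  · exact creation_mul_comm_of_lt h
  · rw [creation_mul_self, neg_zero]
  · rw [creation_mul_comm_of_lt h, neg_neg]

theorem sum_symm_creation (N : ℕ) (s : ℕ → ℕ → F) (hs : ∀ i < N, ∀ j < N, s i j = s j i) :
    ∑ i ∈ Finset.range N, ∑ j ∈ Finset.range N, s i j • (creation F i * creation F j) = 0 := by
  induction N with
  | zero => simp
  | succ N ih =>
    rw [Finset.sum_range_succ, Finset.sum_range_succ, creation_mul_self, smul_zero, add_zero]
    simp only [Finset.sum_range_succ]
    rw [Finset.sum_add_distrib, ih fun i hi j hj => hs i (by omega) j (by omega), zero_add,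
      ← Finset.sum_add_distrib]
    refine Finset.sum_eq_zero fun i hi => ?_
    have := Finset.mem_range.1 hi
    rw [creation_mul_comm N i, hs N (by omega) i (by omega), smul_neg, add_neg_cancel]

/-- Left multiplication by the one-form `∑ uᵢ eᵢ`. -/
def wedgeOp (N : ℕ) (u : ℕ → F) : Module.End F (Finset ℕ → F) :=
  ∑ i ∈ Finset.range N, u i • creation F i

theorem wedgeOp_apply (N : ℕ) (u : ℕ → F) (f : Finset ℕ → F) (K : Finset ℕ) :
    wedgeOp N u f K =
      ∑ i ∈ Finset.range N, if i ∈ K then wedgeSign F i K * (u i * f (K.erase i)) else 0 := by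
  simp only [wedgeOp, LinearMap.sum_apply, LinearMap.smul_apply, Finset.sum_apply, Pi.smul_apply,
    creation_apply, smul_eq_mul, mul_ite, mul_zero]
  refine Finset.sum_congr rfl fun i _ => ?_
  split_ifs
  · ring
  · rfl

theorem wedgeOp_mul_self (N : ℕ) (u : ℕ → F) : wedgeOp N u * wedgeOp N u = 0 := by
  rw [wedgeOp, Finset.sum_mul_sum]
  simp only [smul_mul_smul_comm]
  exact sum_symm_creation N (fun i j => u i * u j) fun i _ j _ => mul_comm _ _

theorem wedgeOp_add (N : ℕ) (u v : ℕ → F) : wedgeOp N (u + v) = wedgeOp N u + wedgeOp N v := by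
  simp [wedgeOp, add_smul, Finset.sum_add_distrib]

theorem wedgeOp_congr {N : ℕ} {u v : ℕ → F} (h : ∀ i < N, u i = v i) :
    wedgeOp N u = wedgeOp N v :=
  Finset.sum_congr rfl fun i hi => by rw [h i (Finset.mem_range.1 hi)]

/-- The exterior derivative on coefficient families, for `d` of functions given by
`g ↦ ∑ Dᵢ g eᵢ` and closed `eᵢ`. -/
def coeffD (N : ℕ) (D : ℕ → Derivation ℤ F F) : (Finset ℕ → F) →+ (Finset ℕ → F) where
  toFun f := ∑ j ∈ Finset.range N, creation F j (fun K => D j (f K))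
  map_zero' := by
    have : (fun _ => 0 : Finset ℕ → F) = 0 := rfl
    simp [this]
  map_add' f g := by
    rw [← Finset.sum_add_distrib]
    refine Finset.sum_congr rfl fun j _ => ?_
    rw [← map_add]
    congr 1
    ext K
    simp

theorem coeffD_apply (N : ℕ) (D : ℕ → Derivation ℤ F F) (f : Finset ℕ → F) :
    coeffD N D f = ∑ j ∈ Finset.range N, creation F j (fun K => D j (f K)) := rfl

theorem coeffD_apply_apply {N : ℕ} {D : ℕ → Derivation ℤ F F} (hD : ∀ i, N ≤ i → D i = 0)
    (f : Finset ℕ → F) (K : Finset ℕ) :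
    coeffD N D f K = ∑ j ∈ K, wedgeSign F j K * D j (f (K.erase j)) := by
  rw [coeffD_apply, Finset.sum_apply]
  simp only [creation_apply]
  rw [← Finset.sum_filter, Finset.filter_mem_eq_inter]
  refine Finset.sum_subset Finset.inter_subset_right fun j hj hj' => ?_
  rw [Finset.mem_inter, Finset.mem_range] at hj'
  rw [hD j (by by_contra hN; exact hj' ⟨by omega, hj⟩)]
  simp

theorem coeffD_smul (N : ℕ) (D : ℕ → Derivation ℤ F F) (g : F) (f : Finset ℕ → F) :
    coeffD N D (g • f) = wedgeOp N (fun i => D i g) f + g • coeffD N D f := by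
  simp only [coeffD_apply, wedgeOp, LinearMap.sum_apply, LinearMap.smul_apply]
  rw [Finset.smul_sum, ← Finset.sum_add_distrib]
  refine Finset.sum_congr rfl fun j _ => ?_
  rw [← map_smul, ← map_smul, ← map_add]
  congr 1
  ext K
  simp [add_comm, mul_comm]

theorem apply_creation (D : Derivation ℤ F F) (j : ℕ) (f : Finset ℕ → F) :
    (fun K => D (creation F j f K)) = creation F j (fun K => D (f K)) := by
  ext K
  rw [creation_apply, creation_apply]
  split_ifs
  · rw [Derivation.apply_wedgeSign_mul]
  · simp

theorem coeffD_wedgeOp (N : ℕ) (D : ℕ → Derivation ℤ F F) {u : ℕ → F}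
    (hu : ∀ i < N, ∀ j < N, D i (u j) = D j (u i)) (f : Finset ℕ → F) :
    coeffD N D (wedgeOp N u f) = -wedgeOp N u (coeffD N D f) := by
  have h1 : ∀ j, (fun K => D j (wedgeOp N u f K)) =
      ∑ i ∈ Finset.range N, (D j (u i) • creation F i f +
        u i • creation F i (fun K => D j (f K))) := by
    intro j
    ext K
    rw [wedgeOp, LinearMap.sum_apply, Finset.sum_apply, map_sum, Finset.sum_apply]
    refine Finset.sum_congr rfl fun i _ => ?_
    rw [← apply_creation]
    simp [add_comm, mul_comm]
  have h2 := LinearMap.congr_fun (sum_symm_creation N (fun j i => D j (u i)) hu) f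
  rw [coeffD_apply]
  simp only [h1, map_sum, map_add, map_smul, Finset.sum_add_distrib]
  simp only [LinearMap.sum_apply, LinearMap.smul_apply, Module.End.mul_apply,
    LinearMap.zero_apply] at h2
  rw [h2, zero_add, Finset.sum_comm]
  simp only [wedgeOp, coeffD_apply, map_sum, LinearMap.sum_apply, LinearMap.smul_apply,
    ← Finset.sum_neg_distrib]
  refine (Finset.sum_congr rfl fun i _ => Finset.sum_congr rfl fun j _ => ?_).trans Finset.sum_comm
  have := LinearMap.congr_fun (creation_mul_comm (F := F) j i) (fun K => D j (f K))
  simp only [LinearMap.neg_apply, Module.End.mul_apply] at this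
  rw [this, smul_neg]

end Fock

noncomputable section FockRep

variable {F : Type} [Field F]

/-- The logarithmic differential `dx/x`. -/
def dlog (x : F) : ExtOmega F := ExteriorAlgebra.ι F (x⁻¹ • KaehlerDifferential.D ℤ F x)

/-- The product of the logarithmic differentials of the entries of a list. -/
def dlogProd (l : List F) : ExtOmega F := (l.map dlog).prod

theorem dlogProd_cons (x : F) (l : List F) : dlogProd (x :: l) = dlog x * dlogProd l := by
  simp [dlogProd]

theorem dlogProd_append (l l' : List F) : dlogProd (l ++ l') = dlogProd l * dlogProd l' := by
  simp [dlogProd]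

theorem logForm_eq_dlogProd {n : ℕ} (x : Fin n → F) : logForm F x = dlogProd (List.ofFn x) := by
  rw [dlogProd, List.map_ofFn]; rfl

theorem dlogProd_eq_logForm (l : List F) : dlogProd l = logForm F l.get := by
  rw [logForm_eq_dlogProd, List.ofFn_get]

/-- The action of the exterior algebra of differential forms on coefficient families determined by
the derivations `D₀, …, D_{N-1}`. -/
def fockRep (N : ℕ) (D : ℕ → Derivation ℤ F F) : ExtOmega F →ₐ[F] Module.End F (Finset ℕ → F) :=
  ExteriorAlgebra.lift F ⟨∑ i ∈ Finset.range N,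
    ((D i).liftKaehlerDifferential).smulRight (creation F i), fun w => by
      have : (∑ i ∈ Finset.range N,
          ((D i).liftKaehlerDifferential).smulRight (creation F i)) w =
          wedgeOp N fun i => (D i).liftKaehlerDifferential w := by
        simp [wedgeOp]
      rw [this, wedgeOp_mul_self]⟩

theorem fockRep_ι (N : ℕ) (D : ℕ → Derivation ℤ F F) (w : Ω[F⁄ℤ]) :
    fockRep N D (ExteriorAlgebra.ι F w) = wedgeOp N fun i => (D i).liftKaehlerDifferential w := by
  rw [fockRep, ExteriorAlgebra.lift_ι_apply]
  simp [wedgeOp]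

theorem fockRep_dform (N : ℕ) (D : ℕ → Derivation ℤ F F) (x : F) :
    fockRep N D (dform F x) = wedgeOp N fun i => D i x := by
  rw [dform, fockRep_ι]
  simp only [Derivation.liftKaehlerDifferential_comp_D]

theorem fockRep_dlog (N : ℕ) (D : ℕ → Derivation ℤ F F) (x : F) :
    fockRep N D (dlog x) = wedgeOp N fun i => x⁻¹ * D i x := by
  rw [dlog, fockRep_ι]
  simp only [map_smul, Derivation.liftKaehlerDifferential_comp_D, smul_eq_mul]

/-- The coefficients of a differential form. -/
def fock (N : ℕ) (D : ℕ → Derivation ℤ F F) : ExtOmega F →ₗ[F] (Finset ℕ → F) :=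
  (LinearMap.applyₗ (Pi.single ∅ 1)).comp (fockRep N D).toLinearMap

theorem fock_apply (N : ℕ) (D : ℕ → Derivation ℤ F F) (ω : ExtOmega F) :
    fock N D ω = fockRep N D ω (Pi.single ∅ 1) := rfl

theorem fock_mul (N : ℕ) (D : ℕ → Derivation ℤ F F) (η ω : ExtOmega F) :
    fock N D (η * ω) = fockRep N D η (fock N D ω) := by
  simp [fock_apply]

theorem fock_one (N : ℕ) (D : ℕ → Derivation ℤ F F) : fock N D 1 = Pi.single ∅ 1 := by
  simp [fock_apply]

theorem fock_dlogProd_cons (N : ℕ) (D : ℕ → Derivation ℤ F F) (x : F) (l : List F) :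
    fock N D (dlogProd (x :: l)) =
      wedgeOp N (fun i => x⁻¹ * D i x) (fock N D (dlogProd l)) := by
  rw [dlogProd_cons, fock_mul, fockRep_dlog]

/-- The group generated by the logarithmic `n`-forms with entries in `L`. -/
def logGroup (L : Subfield F) (n : ℕ) : AddSubgroup (ExtOmega F) :=
  AddSubgroup.closure {ω | ∃ l : List F, l.length = n ∧ (∀ x ∈ l, x ∈ L ∧ x ≠ 0) ∧ ω = dlogProd l}

end FockRep

namespace IsDualSystem

variable {F : Type} [Field F] {p : ℕ} [hp : Fact p.Prime] [CharP F p] {N : ℕ} {b : ℕ → F}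
  {D : ℕ → Derivation ℤ F F}

theorem wedgeOp_mem (L : Subfield F) {u : ℕ → F} (hu : ∀ i < N, u i ∈ L) {f : Finset ℕ → F}
    (hf : ∀ K, f K ∈ L) (K : Finset ℕ) : wedgeOp N u f K ∈ L := by
  rw [wedgeOp_apply]
  refine sum_mem fun i hi => ?_
  split_ifs
  · exact mul_mem (wedgeSign_mem _ _ _) (mul_mem (hu i (Finset.mem_range.1 hi)) (hf _))
  · exact zero_mem _

theorem support_wedgeOp {n : ℕ} {u : ℕ → F} {f : Finset ℕ → F}
    (hf : ∀ K, f K ≠ 0 → K ⊆ Finset.range N ∧ K.card = n) (K : Finset ℕ)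
    (hK : wedgeOp N u f K ≠ 0) : K ⊆ Finset.range N ∧ K.card = n + 1 := by
  rw [wedgeOp_apply] at hK
  obtain ⟨i, hi, hne⟩ := Finset.exists_ne_zero_of_sum_ne_zero hK
  split_ifs at hne with hiK
  · obtain ⟨h1, h2⟩ := hf (K.erase i) fun h0 => hne (by rw [h0]; simp)
    rw [← h2, Finset.card_erase_add_one hiK, ← Finset.insert_erase hiK]
    exact ⟨Finset.insert_subset hi h1, by simp⟩
  · exact absurd rfl hne

variable (h : IsDualSystem N b D)
include h

theorem closed_dlog {x : F} (hx : x ∈ genField F p b N) (i j : ℕ) :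
    D i (x⁻¹ * D j x) = D j (x⁻¹ * D i x) := by
  simp only [Derivation.leibniz, Derivation.leibniz_inv, h.apply_comm i j hx, smul_eq_mul]
  ring

theorem fock_dlogProd {l : List F} (hl : ∀ x ∈ l, x ∈ genField F p b N ∧ x ≠ 0) :
    (∀ K, fock N D (dlogProd l) K ∈ genField F p b N) ∧
    coeffD N D (fock N D (dlogProd l)) = 0 ∧
    (∃ g : Finset ℕ → F, (∀ K, g K ∈ genField F p b N) ∧
      fock N D (dlogProd l) - (fun K => fock N D (dlogProd l) K ^ p) = coeffD N D g) ∧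
    ∀ K, fock N D (dlogProd l) K ≠ 0 → K ⊆ Finset.range N ∧ K.card = l.length := by
  induction l with
  | nil =>
    have h1 : dlogProd ([] : List F) = 1 := by simp [dlogProd]
    rw [h1, fock_one]
    refine ⟨fun K => ?_, ?_, ⟨0, fun _ => zero_mem _, ?_⟩, fun K hK => ?_⟩
    · by_cases hK : K = ∅
      · subst hK; simp
      · simp [Pi.single_eq_of_ne hK]
    · ext K
      rw [coeffD_apply_apply h.eq_zero]
      refine Finset.sum_eq_zero fun j _ => ?_
      by_cases hK : K.erase j = ∅
      · simp [hK]
      · simp [Pi.single_eq_of_ne hK]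
    · rw [map_zero]
      ext K
      by_cases hK : K = ∅
      · subst hK; simp
      · simp [Pi.single_eq_of_ne hK, hp.out.ne_zero]
    · by_cases hK' : K = ∅
      · subst hK'; simp
      · simp [Pi.single_eq_of_ne hK'] at hK
  | cons x l ih =>
    obtain ⟨hL, hcl, ⟨g, hgL, hg⟩, hsupp⟩ := ih fun y hy => hl y (List.mem_cons_of_mem _ hy)
    obtain ⟨hx, hx0⟩ := hl x List.mem_cons_self
    rw [fock_dlogProd_cons]
    set f := fock N D (dlogProd l)
    set u : ℕ → F := fun i => x⁻¹ * D i x with hu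
    have huL : ∀ i < N, u i ∈ genField F p b N := fun i _ =>
      mul_mem (inv_mem hx) (h.apply_mem le_rfl i hx)
    refine ⟨wedgeOp_mem _ huL hL, ?_, ?_, fun K hK => ?_⟩
    · rw [coeffD_wedgeOp _ _ fun i _ j _ => h.closed_dlog hx i j, hcl, map_zero, neg_zero]
    · obtain ⟨e, heL, he⟩ := h.exists_logDeriv_sub_eq hx hx0
      refine ⟨e • f - wedgeOp N (fun i => u i ^ p) g, fun K => sub_mem (mul_mem heL (hL K))
        (wedgeOp_mem _ (fun i hi => pow_mem (huL i hi) _) hgL K), ?_⟩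
      have h1 : (fun K => wedgeOp N u f K ^ p) = wedgeOp N (fun i => u i ^ p) fun K => f K ^ p := by
        ext K
        rw [wedgeOp_apply, wedgeOp_apply, sum_pow_char]
        refine Finset.sum_congr rfl fun i _ => ?_
        split_ifs
        · rw [mul_pow, mul_pow, wedgeSign_pow]
        · exact zero_pow hp.out.ne_zero
      have h2 : wedgeOp N u = wedgeOp N (fun i => D i e) + wedgeOp N fun i => u i ^ p := by
        rw [← wedgeOp_add]
        refine wedgeOp_congr fun i _ => ?_
        rw [Pi.add_apply, ← he i]
        ring
      rw [h1, h2, map_sub, coeffD_smul, hcl, smul_zero, add_zero,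
        coeffD_wedgeOp _ _ fun i _ j _ => by
          rw [Derivation.apply_pow_char, Derivation.apply_pow_char], ← hg, map_sub,
        LinearMap.add_apply]
      abel
    · exact support_wedgeOp hsupp K hK

theorem fock_logGroup {n : ℕ} {ω : ExtOmega F} (hω : ω ∈ logGroup (genField F p b N) n) :
    (∀ K, fock N D ω K ∈ genField F p b N) ∧
    coeffD N D (fock N D ω) = 0 ∧
    (∃ g : Finset ℕ → F, (∀ K, g K ∈ genField F p b N) ∧
      fock N D ω - (fun K => fock N D ω K ^ p) = coeffD N D g) ∧
    ∀ K, fock N D ω K ≠ 0 → K ⊆ Finset.range N ∧ K.card = n := by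
  induction hω using AddSubgroup.closure_induction with
  | mem ω hω =>
    obtain ⟨l, rfl, hl, rfl⟩ := hω
    exact h.fock_dlogProd hl
  | zero =>
    refine ⟨fun K => ?_, ?_, ⟨0, fun _ => zero_mem _, ?_⟩, fun K hK => ?_⟩
    · simp
    · simp
    · ext K; simp [hp.out.ne_zero]
    · simp at hK
  | add ω ω' _ _ ih ih' =>
    obtain ⟨hL, hcl, ⟨g, hgL, hg⟩, hsupp⟩ := ih
    obtain ⟨hL', hcl', ⟨g', hgL', hg'⟩, hsupp'⟩ := ih'
    refine ⟨fun K => ?_, ?_, ⟨g + g', fun K => add_mem (hgL K) (hgL' K), ?_⟩, fun K hK => ?_⟩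
    · rw [map_add]; exact add_mem (hL K) (hL' K)
    · rw [map_add, map_add, hcl, hcl', add_zero]
    · rw [map_add (coeffD N D), ← hg, ← hg']
      ext K
      simp only [map_add, Pi.add_apply, Pi.sub_apply, add_pow_char]
      ring
    · by_cases h0 : fock N D ω K = 0
      · refine hsupp' K fun h0' => hK ?_
        rw [map_add, Pi.add_apply, h0, h0', add_zero]
      · exact hsupp K h0
  | neg ω _ ih =>
    obtain ⟨hL, hcl, ⟨g, hgL, hg⟩, hsupp⟩ := ih
    refine ⟨fun K => ?_, ?_, ⟨-g, fun K => neg_mem (hgL K), ?_⟩, fun K hK => ?_⟩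
    · rw [map_neg]; exact neg_mem (hL K)
    · rw [map_neg, map_neg, hcl, neg_zero]
    · rw [map_neg (coeffD N D), ← hg]
      ext K
      have : ∀ x : F, (-x) ^ p = -x ^ p := fun x => by
        rw [← frobenius_def, map_neg, frobenius_def]
      simp only [map_neg, Pi.neg_apply, Pi.sub_apply, this]
      ring
    · exact hsupp K fun h0 => hK (by rw [map_neg, Pi.neg_apply, h0, neg_zero])

end IsDualSystem

/-- The position of a finite set of natural numbers in the colexicographic order. -/
def colexWeight (K : Finset ℕ) : ℕ := ∑ i ∈ K, 2 ^ i

theorem colexWeight_injective : Function.Injective colexWeight :=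
  Finset.geomSum_injective le_rfl

theorem colexWeight_insert {i : ℕ} {K : Finset ℕ} (hi : i ∉ K) :
    colexWeight (insert i K) = 2 ^ i + colexWeight K :=
  Finset.sum_insert hi

theorem colexWeight_erase {i : ℕ} {K : Finset ℕ} (hi : i ∈ K) :
    colexWeight (K.erase i) + 2 ^ i = colexWeight K :=
  Finset.sum_erase_add _ _ hi

namespace IsDualSystem

variable {F : Type} [Field F] {p : ℕ} [hp : Fact p.Prime] [CharP F p] {N : ℕ} {b : ℕ → F}
  {D : ℕ → Derivation ℤ F F} (h : IsDualSystem N b D)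
include h

theorem fock_dlogProd_leading {y : ℕ → F} {l : List ℕ} (hl : l.Pairwise (· < ·))
    (hN : ∀ i ∈ l, i < N) (hy : ∀ i ∈ l, y i ∈ genField F p b (i + 1)) (K : Finset ℕ)
    (hK : colexWeight l.toFinset ≤ colexWeight K) :
    fock N D (dlogProd (l.map y)) K =
      if K = l.toFinset then ∏ i ∈ l.toFinset, (y i)⁻¹ * D i (y i) else 0 := by
  induction l generalizing K with
  | nil =>
    have h1 : dlogProd ([] : List F) = 1 := by simp [dlogProd]
    rw [List.map_nil, h1, fock_one]
    by_cases hK : K = ∅ <;> simp [hK]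
  | cons i l ih =>
    rw [List.pairwise_cons] at hl
    have hil : i ∉ l.toFinset := fun hi => (hl.1 i (List.mem_toFinset.1 hi)).false
    rw [List.toFinset_cons, colexWeight_insert hil] at hK
    have ih := ih hl.2 (fun j hj => hN j (List.mem_cons_of_mem _ hj))
      (fun j hj => hy j (List.mem_cons_of_mem _ hj))
    have hiN := hN i List.mem_cons_self
    have hterm : ∀ j ∈ Finset.range N, j ∈ K → (j ≠ i ∨ K.erase j ≠ l.toFinset) →
        wedgeSign F j K * ((y i)⁻¹ * D j (y i) * fock N D (dlogProd (l.map y)) (K.erase j)) = 0 := by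
      intro j hj hjK hne
      rcases lt_or_ge i j with hij | hij
      · rw [h.apply_eq_zero (s := i + 1) (by omega) hij (hy i List.mem_cons_self)]
        simp
      · have h2 : 2 ^ j ≤ 2 ^ i := Nat.pow_le_pow_right (by norm_num) hij
        have h3 := colexWeight_erase hjK
        rw [ih (K.erase j) (by omega), if_neg, mul_zero, mul_zero]
        intro h4
        rw [h4] at h3
        rcases hne with hne | hne
        · have : 2 ^ j < 2 ^ i := Nat.pow_lt_pow_right (by norm_num) (by omega)
          omega
        · exact hne h4
    rw [List.map_cons, fock_dlogProd_cons, wedgeOp_apply, List.toFinset_cons]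
    split_ifs with hKi
    · subst hKi
      rw [Finset.sum_eq_single i]
      · rw [if_pos (Finset.mem_insert_self _ _), wedgeSign_eq_one, one_mul, Finset.erase_insert hil,
          ih _ le_rfl, if_pos rfl, Finset.prod_insert hil]
        intro j hj
        rcases Finset.mem_insert.1 hj with rfl | hj
        · exact le_rfl
        · exact (hl.1 j (List.mem_toFinset.1 hj)).le
      · intro j hj hji
        split_ifs with hjK
        · exact hterm j hj hjK (Or.inl hji)
        · rfl
      · intro hi
        exact absurd (Finset.mem_range.2 hiN) hi
    · refine Finset.sum_eq_zero fun j hj => ?_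
      split_ifs with hjK
      · refine hterm j hj hjK ?_
        by_contra! hcon
        exact hKi (by rw [← hcon.2, ← hcon.1, Finset.insert_erase hjK])
      · rfl

theorem exists_dlogProd_coeff (hF : ∀ x : F, ∃ y : F, y ^ (p - 1) = x) {n : ℕ} {ω : ExtOmega F}
    (hω : ω ∈ logGroup (genField F p b N) n) {I : Finset ℕ} (hI : fock N D ω I ≠ 0)
    (hmax : ∀ K, colexWeight I < colexWeight K → fock N D ω K = 0) :
    ∃ (y : ℕ → F) (z : ℤ), (∀ i ∈ I, y i ∈ genField F p b (i + 1) ∧ y i ≠ 0) ∧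
      fock N D ω I = z * ∏ i ∈ I, (y i)⁻¹ * D i (y i) := by
  obtain ⟨hL, hcl, ⟨g, hgL, hg⟩, hsupp⟩ := h.fock_logGroup hω
  have hIN : ∀ i ∈ I, i < N := fun i hi => Finset.mem_range.1 ((hsupp I hI).1 hi)
  obtain ⟨γ, z, hγ, hc⟩ := h.exists_factorization hF I hIN (hL I) hI (by
    intro q hqN hqI
    refine ⟨fun j => wedgeSign F q (insert q I) * (wedgeSign F j (insert q I) *
      -fock N D ω ((insert q I).erase j)), fun j => mul_mem (wedgeSign_mem _ _ _)
        (mul_mem (wedgeSign_mem _ _ _) (neg_mem (hL _))), ?_⟩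
    have h1 := congrFun hcl (insert q I)
    rw [coeffD_apply_apply h.eq_zero, Finset.sum_insert hqI, Finset.erase_insert hqI,
      Pi.zero_apply] at h1
    have h2 : ∑ j ∈ I with q < j, wedgeSign F j (insert q I) *
        D j (fock N D ω ((insert q I).erase j)) = ∑ j ∈ I, wedgeSign F j (insert q I) *
        D j (fock N D ω ((insert q I).erase j)) := by
      refine Finset.sum_filter_of_ne fun j hj hne => ?_
      by_contra hjq
      have hjq' : j < q := lt_of_le_of_ne (not_lt.1 hjq) fun e => hqI (e ▸ hj)
      refine hne ?_
      rw [hmax, map_zero, mul_zero]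
      have h3 := colexWeight_erase (Finset.mem_insert_of_mem hj : j ∈ insert q I)
      rw [colexWeight_insert hqI] at h3
      have : 2 ^ j < 2 ^ q := Nat.pow_lt_pow_right (by norm_num) hjq'
      omega
    rw [← h2] at h1
    simp only [Derivation.apply_wedgeSign_mul, map_neg, mul_neg, Finset.sum_neg_distrib,
      ← Finset.mul_sum]
    have h4 := wedgeSign_mul_self (F := F) q (insert q I)
    linear_combination wedgeSign F q (insert q I) * h1 - D q (fock N D ω I) * h4)
    ⟨fun j => wedgeSign F j I * g (I.erase j), fun j => mul_mem (wedgeSign_mem _ _ _) (hgL _), by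
      have h1 := congrFun hg I
      rw [coeffD_apply_apply h.eq_zero] at h1
      simp only [Derivation.apply_wedgeSign_mul]
      exact h1⟩
  have hy : ∀ i, ∃ y, i ∈ I → y ∈ genField F p b (i + 1) ∧ y ≠ 0 ∧ D i y = γ i * y := by
    intro i
    by_cases hi : i ∈ I
    · obtain ⟨y, h1, h2, h3⟩ := h.exists_logDeriv (hIN i hi) (hγ i hi).1 (hγ i hi).2
      exact ⟨y, fun _ => ⟨h1, h2, h3⟩⟩
    · exact ⟨0, fun h => absurd h hi⟩
  choose y hy using hy
  refine ⟨y, z, fun i hi => ⟨(hy i hi).1, (hy i hi).2.1⟩, ?_⟩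
  rw [hc]
  congr 1
  refine Finset.prod_congr rfl fun i hi => ?_
  rw [(hy i hi).2.2]
  field_simp [(hy i hi).2.1]

end IsDualSystem

section Span

variable {F : Type} [Field F] {p : ℕ} [hp : Fact p.Prime] [CharP F p]

omit hp in
theorem kaehlerD_mem_span {C : Set F} {x : F} (hx : x ∈ pClosure F p C) :
    KaehlerDifferential.D ℤ F x ∈ Submodule.span F (KaehlerDifferential.D ℤ F '' C) := by
  refine Subfield.closure_induction
    (p := fun x _ => KaehlerDifferential.D ℤ F x ∈ Submodule.span F (KaehlerDifferential.D ℤ F '' C))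
    ?_ ?_ ?_ ?_ ?_ ?_ hx
  · rintro z (⟨x, rfl⟩ | hz)
    · have : KaehlerDifferential.D ℤ F (x ^ p ^ 1) = 0 := by
        rw [pow_one, Derivation.leibniz_pow, ← Nat.cast_smul_eq_nsmul F, CharP.cast_eq_zero,
          zero_smul]
      simp only [this, zero_mem]
    · exact Submodule.subset_span ⟨z, hz, rfl⟩
  · simp
  · intro x y _ _ h1 h2
    rw [map_add]; exact add_mem h1 h2
  · intro x _ h1
    rw [map_neg]; exact neg_mem h1
  · intro x _ h1
    rw [Derivation.leibniz_inv]
    exact Submodule.smul_mem _ _ h1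
  · intro x y _ _ h1 h2
    rw [Derivation.leibniz]
    exact add_mem (Submodule.smul_mem _ _ h2) (Submodule.smul_mem _ _ h1)

omit hp in
theorem dform_mem_span {C : Set F} {x : F} (hx : x ∈ pClosure F p C) :
    dform F x ∈ Submodule.span F (dform F '' C) := by
  have := Submodule.mem_map_of_mem (f := ExteriorAlgebra.ι F) (kaehlerD_mem_span hx)
  rwa [Submodule.map_span, ← Set.image_comp] at this

theorem dlog_eq_smul (x : F) : dlog x = x⁻¹ • dform F x := by
  rw [dlog, dform, map_smul]

theorem dlog_mul_self (x : F) : dlog x * dlog x = 0 := ExteriorAlgebra.ι_sq_zero _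

theorem dlog_mul_comm (x y : F) : dlog x * dlog y = -(dlog y * dlog x) := by
  rw [eq_neg_iff_add_eq_zero]
  exact ExteriorAlgebra.ι_add_mul_swap _ _

end Span

theorem exists_sorted_mul_eq {A : Type*} [Ring A] (v : ℕ → A) (hsq : ∀ i, v i * v i = 0)
    (hanti : ∀ i j, v i * v j = -(v j * v i)) (i : ℕ) {l : List ℕ} (hl : l.Pairwise (· < ·)) :
    ∃ l' : List ℕ, l'.Pairwise (· < ·) ∧ (∀ j ∈ l', j = i ∨ j ∈ l) ∧
      (v i * (l.map v).prod = (l'.map v).prod ∨ v i * (l.map v).prod = -(l'.map v).prod ∨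
        v i * (l.map v).prod = 0) := by
  induction l with
  | nil => exact ⟨[i], by simp, by simp, by simp⟩
  | cons j l ih =>
    have hl' := List.pairwise_cons.1 hl
    rcases lt_trichotomy i j with hij | rfl | hij
    · refine ⟨i :: j :: l, ?_, by simp, by simp⟩
      refine List.pairwise_cons.2 ⟨fun m hm => ?_, hl⟩
      rcases List.mem_cons.1 hm with rfl | hm
      · exact hij
      · exact hij.trans (hl'.1 m hm)
    · refine ⟨[], by simp, by simp, Or.inr (Or.inr ?_)⟩
      rw [List.map_cons, List.prod_cons, ← mul_assoc, hsq, zero_mul]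
    · obtain ⟨l', h1, h2, h3⟩ := ih hl'.2
      refine ⟨j :: l', List.pairwise_cons.2 ⟨fun m hm => ?_, h1⟩, fun m hm => ?_, ?_⟩
      · rcases h2 m hm with rfl | hm
        · exact hij
        · exact hl'.1 m hm
      · rcases List.mem_cons.1 hm with rfl | hm
        · simp
        · rcases h2 m hm with rfl | hm <;> simp [*]
      · simp only [List.map_cons, List.prod_cons]
        rw [← mul_assoc, hanti, neg_mul, mul_assoc]
        rcases h3 with h3 | h3 | h3 <;> rw [h3] <;> simp

theorem creation_single {F : Type} [Field F] {i : ℕ} {K : Finset ℕ} (h : ∀ j ∈ K, i < j) :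
    creation F i (Pi.single K 1) = Pi.single (insert i K) 1 := by
  have hi : i ∉ K := fun hi => (h i hi).false
  ext J
  rw [creation_apply]
  by_cases hJ : J = insert i K
  · subst hJ
    rw [if_pos (Finset.mem_insert_self _ _), Finset.erase_insert hi, Pi.single_eq_same,
      Pi.single_eq_same, wedgeSign_eq_one, one_mul]
    intro j hj
    rcases Finset.mem_insert.1 hj with rfl | hj
    · exact le_rfl
    · exact (h j hj).le
  · rw [Pi.single_eq_of_ne hJ]
    split_ifs with hiJ
    · rw [Pi.single_eq_of_ne, mul_zero]
      rintro rfl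
      exact hJ (Finset.insert_erase hiJ).symm
    · rfl

namespace IsDualSystem

variable {F : Type} [Field F] {N : ℕ} {b : ℕ → F}
  {D : ℕ → Derivation ℤ F F} (h : IsDualSystem N b D)
include h

theorem fockRep_dform_self {i : ℕ} (hi : i < N) :
    fockRep N D (dform F (b i)) = b i • creation F i := by
  rw [fockRep_dform, wedgeOp, Finset.sum_eq_single i]
  · rw [h.apply_self i hi]
  · intro j _ hj
    rw [h.apply_ne j i hi hj, zero_smul]
  · intro hi'
    exact absurd (Finset.mem_range.2 hi) hi'

theorem fockRep_dlog_self {i : ℕ} (hi : i < N) : fockRep N D (dlog (b i)) = creation F i := by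
  rw [dlog_eq_smul, map_smul, h.fockRep_dform_self hi, inv_smul_smul₀ (h.ne_zero i hi)]

theorem fock_dlogProd_self {l : List ℕ} (hl : l.Pairwise (· < ·)) (hN : ∀ i ∈ l, i < N) :
    fock N D (dlogProd (l.map b)) = Pi.single l.toFinset 1 := by
  induction l with
  | nil => simp [dlogProd, fock_one]
  | cons i l ih =>
    have hl' := List.pairwise_cons.1 hl
    rw [List.map_cons, dlogProd_cons, fock_mul, h.fockRep_dlog_self (hN i List.mem_cons_self),
      ih hl'.2 fun j hj => hN j (List.mem_cons_of_mem _ hj), creation_single, List.toFinset_cons]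
    exact fun j hj => hl'.1 j (List.mem_toFinset.1 hj)

variable {p : ℕ} [hp : Fact p.Prime] [CharP F p]

theorem logGroup_le_span {n : ℕ} {ω : ExtOmega F} (hω : ω ∈ logGroup (genField F p b N) n) :
    ω ∈ Submodule.span F {η | ∃ l : List ℕ, l.Pairwise (· < ·) ∧ (∀ i ∈ l, i < N) ∧
      η = dlogProd (l.map b)} := by
  set M := Submodule.span F {η | ∃ l : List ℕ, l.Pairwise (· < ·) ∧ (∀ i ∈ l, i < N) ∧
      η = dlogProd (l.map b)}
  have hb : ∀ i < N, ∀ m ∈ M, dform F (b i) * m ∈ M := by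
    intro i hi m hm
    induction hm using Submodule.span_induction with
    | mem m hm =>
      obtain ⟨l, h1, h2, rfl⟩ := hm
      have : dform F (b i) = b i • dlog (b i) := by
        rw [dlog_eq_smul, smul_inv_smul₀ (h.ne_zero i hi)]
      rw [this, smul_mul_assoc]
      refine Submodule.smul_mem _ _ ?_
      obtain ⟨l', h3, h4, h5⟩ := exists_sorted_mul_eq (fun i => dlog (b i))
        (fun i => dlog_mul_self _) (fun i j => dlog_mul_comm _ _) i h1
      have h6 : dlogProd (l'.map b) ∈ M := Submodule.subset_span ⟨l', h3, fun j hj => by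
        rcases h4 j hj with rfl | hj
        · exact hi
        · exact h2 j hj, rfl⟩
      have h7 : ∀ l : List ℕ, dlogProd (l.map b) = (l.map fun i => dlog (b i)).prod := fun l => by
        rw [dlogProd, List.map_map]; rfl
      rw [h7] at h6 ⊢
      rcases h5 with h5 | h5 | h5 <;> rw [h5]
      · exact h6
      · exact neg_mem h6
      · exact zero_mem _
    | zero => rw [mul_zero]; exact zero_mem _
    | add x y _ _ hx hy => rw [mul_add]; exact add_mem hx hy
    | smul a x _ hx => rw [mul_smul_comm]; exact Submodule.smul_mem _ _ hx
  have hx : ∀ x ∈ genField F p b N, ∀ m ∈ M, dlog x * m ∈ M := by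
    intro x hx m hm
    rw [dlog_eq_smul, smul_mul_assoc]
    refine Submodule.smul_mem _ _ ?_
    have := dform_mem_span hx
    generalize dform F x = v at this
    induction this using Submodule.span_induction with
    | mem _ hm' =>
      obtain ⟨_, ⟨i, hi, rfl⟩, rfl⟩ := hm'
      exact hb i hi m hm
    | zero => rw [zero_mul]; exact zero_mem _
    | add x y _ _ hx hy => rw [add_mul]; exact add_mem hx hy
    | smul a x _ hx => rw [smul_mul_assoc]; exact Submodule.smul_mem _ _ hx
  have hl : ∀ l : List F, (∀ x ∈ l, x ∈ genField F p b N) → dlogProd l ∈ M := by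
    intro l hl
    induction l with
    | nil => exact Submodule.subset_span ⟨[], by simp⟩
    | cons x l ih =>
      rw [dlogProd_cons]
      exact hx x (hl x List.mem_cons_self) _ (ih fun y hy => hl y (List.mem_cons_of_mem _ hy))
  have hle : logGroup (genField F p b N) n ≤ M.toAddSubgroup := by
    refine (AddSubgroup.closure_le _).2 ?_
    rintro _ ⟨l, -, hl', rfl⟩
    exact hl l fun x hx => (hl' x hx).1
  exact hle hω

theorem eq_zero_of_fock_eq_zero {n : ℕ} {ω : ExtOmega F}
    (hω : ω ∈ logGroup (genField F p b N) n) (h0 : fock N D ω = 0) : ω = 0 := by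
  let Ψ : (Finset ℕ → F) →ₗ[F] ExtOmega F := ∑ K ∈ (Finset.range N).powerset,
    (LinearMap.proj K : (Finset ℕ → F) →ₗ[F] F).smulRight (dlogProd (K.sort.map b))
  have key : ∀ η ∈ Submodule.span F {η | ∃ l : List ℕ, l.Pairwise (· < ·) ∧ (∀ i ∈ l, i < N) ∧
      η = dlogProd (l.map b)}, Ψ (fock N D η) = η := by
    intro η hη
    induction hη using Submodule.span_induction with
    | mem η hη =>
      obtain ⟨l, h1, h2, rfl⟩ := hη
      have h3 : l.toFinset.sort = l :=
        (List.toFinset_sort (r := (· ≤ ·)) (h1.imp fun h => h.ne)).2 (h1.imp fun h => h.le)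
      rw [h.fock_dlogProd_self h1 h2]
      simp only [Ψ, LinearMap.sum_apply, LinearMap.smulRight_apply, LinearMap.proj_apply]
      rw [Finset.sum_eq_single l.toFinset]
      · rw [Pi.single_eq_same, one_smul, h3]
      · intro K _ hK
        rw [Pi.single_eq_of_ne hK, zero_smul]
      · intro hl
        refine absurd (Finset.mem_powerset.2 fun i hi => ?_) hl
        exact Finset.mem_range.2 (h2 i (List.mem_toFinset.1 hi))
    | zero => simp
    | add x y _ _ hx hy => rw [map_add, map_add, hx, hy]
    | smul a x _ hx => rw [map_smul, map_smul, hx]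
  rw [← key ω (h.logGroup_le_span hω), h0, map_zero]

/-- Every element of `logGroup` is reduced to zero by subtracting logarithmic forms with the same
leading coefficient. -/
theorem mem_of_dlogProd_mem (hF : ∀ x : F, ∃ y : F, y ^ (p - 1) = x) {n k t : ℕ}
    {A G : AddSubgroup (ExtOmega F)}
    (hA : ∀ ω ∈ A, ω ∈ logGroup (genField F p b N) n → ∀ K, fock N D ω K ≠ 0 →
      t ≤ (K.filter (· < k)).card)
    (hGA : G ≤ A)
    (hG : ∀ l l' : List F, l.length + l'.length = n → t ≤ l.length →
      (∀ x ∈ l, x ∈ genField F p b k ∧ x ≠ 0) → (∀ x ∈ l', x ≠ 0) → dlogProd (l ++ l') ∈ G)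
    {ω : ExtOmega F} (hωA : ω ∈ A) (hω : ω ∈ logGroup (genField F p b N) n) : ω ∈ G := by
  suffices H : ∀ (W : ℕ), ∀ ω ∈ A, ω ∈ logGroup (genField F p b N) n →
      (∀ K, fock N D ω K ≠ 0 → colexWeight K < W) → ω ∈ G by
    refine H (colexWeight (Finset.range N) + 1) ω hωA hω fun K hK => Nat.lt_succ_of_le ?_
    exact Finset.sum_le_sum_of_subset ((h.fock_logGroup hω).2.2.2 K hK).1
  intro W
  induction W with
  | zero =>
    intro ω _ hω hW
    have : fock N D ω = 0 := by
      ext K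
      by_contra hK
      exact absurd (hW K hK) (Nat.not_lt_zero _)
    rw [h.eq_zero_of_fock_eq_zero hω this]
    exact zero_mem _
  | succ W ih =>
    intro ω hωA hω hW
    by_cases hI : ∃ I, fock N D ω I ≠ 0 ∧ colexWeight I = W
    · obtain ⟨I, hI, rfl⟩ := hI
      have hmax : ∀ K, colexWeight I < colexWeight K → fock N D ω K = 0 := by
        intro K hK
        by_contra h0
        have := hW K h0
        omega
      obtain ⟨y, z, hy, hc⟩ := h.exists_dlogProd_coeff hF hω hI hmax
      obtain ⟨hIN, hIn⟩ := (h.fock_logGroup hω).2.2.2 I hI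
      set l := (I.filter (· < k)).sort with hl
      set l' := (I.filter (¬ · < k)).sort with hl'
      have hlmem : ∀ i ∈ l, i ∈ I ∧ i < k := fun i hi => by
        rw [hl, Finset.mem_sort, Finset.mem_filter] at hi; exact hi
      have hlmem' : ∀ i ∈ l', i ∈ I ∧ k ≤ i := fun i hi => by
        rw [hl', Finset.mem_sort, Finset.mem_filter, not_lt] at hi; exact hi
      have hsorted : (l ++ l').Pairwise (· < ·) := by
        rw [List.pairwise_append]
        exact ⟨(Finset.sortedLT_sort _).pairwise, (Finset.sortedLT_sort _).pairwise,
          fun i hi j hj => (hlmem i hi).2.trans_le (hlmem' j hj).2⟩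
      have hto : (l ++ l').toFinset = I := by
        rw [List.toFinset_append, hl, hl', Finset.sort_toFinset, Finset.sort_toFinset,
          Finset.filter_union_filter_not_eq]
      have hmemI : ∀ i ∈ l ++ l', i ∈ I := fun i hi => by
        rw [← hto]; exact List.mem_toFinset.2 hi
      have hlen : l.length + l'.length = n := by
        rw [hl, hl', Finset.length_sort, Finset.length_sort,
          Finset.card_filter_add_card_filter_not, hIn]
      set η := dlogProd ((l ++ l').map y) with hη
      have hηG : η ∈ G := by
        rw [hη, List.map_append]
        refine hG _ _ (by simpa using hlen) ?_ ?_ ?_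
        · rw [List.length_map, hl, Finset.length_sort]
          exact hA ω hωA hω I hI
        · intro x hx
          obtain ⟨i, hi, rfl⟩ := List.mem_map.1 hx
          exact ⟨genField_mono b (hlmem i hi).2 (hy i (hlmem i hi).1).1, (hy i (hlmem i hi).1).2⟩
        · intro x hx
          obtain ⟨i, hi, rfl⟩ := List.mem_map.1 hx
          exact (hy i (hlmem' i hi).1).2
      have hηL : η ∈ logGroup (genField F p b N) n := by
        refine AddSubgroup.subset_closure ⟨_, by simpa using hlen, fun x hx => ?_, rfl⟩
        obtain ⟨i, hi, rfl⟩ := List.mem_map.1 hx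
        have hiI := hmemI i hi
        exact ⟨genField_mono b (Finset.mem_range.1 (hIN hiI)) (hy i hiI).1, (hy i hiI).2⟩
      have hηlead := h.fock_dlogProd_leading (y := y) hsorted
        (fun i hi => Finset.mem_range.1 (hIN (hmemI i hi))) (fun i hi => (hy i (hmemI i hi)).1)
      rw [hto, ← hη] at hηlead
      have hsub : ω - z • η ∈ G := by
        refine ih _ (sub_mem hωA (zsmul_mem (hGA hηG) z)) (sub_mem hω (zsmul_mem hηL z)) ?_
        intro K hK
        by_contra hKW
        rw [not_lt] at hKW
        refine hK ?_
        rw [map_sub, map_zsmul, Pi.sub_apply, Pi.smul_apply, hηlead K hKW]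
        split_ifs with hKI
        · rw [hKI, hc, zsmul_eq_mul, sub_self]
        · rw [smul_zero, sub_zero]
          exact hmax K (lt_of_le_of_ne hKW fun e => hKI (colexWeight_injective e.symm))
      have := add_mem hsub (zsmul_mem hηG z)
      rwa [sub_add_cancel] at this
    · refine ih ω hωA hω fun K hK => ?_
      have := hW K hK
      have h2 : colexWeight K ≠ W := fun e => hI ⟨K, hK, e⟩
      omega

end IsDualSystem

noncomputable section DiffSpan

variable {F : Type} [Field F]

/-- The `F`-span of the differentials of the elements of a set. -/
def diffSpan (C : Set F) : Submodule F (ExtOmega F) := Submodule.span F (dform F '' C)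

theorem Submodule.list_prod_mem_pow_length {R A : Type*} [CommSemiring R] [Semiring A] [Algebra R A]
    (M : Submodule R A) {l : List A} (hl : ∀ x ∈ l, x ∈ M) : l.prod ∈ M ^ l.length := by
  induction l with
  | nil => exact Submodule.one_le.1 (pow_zero M).ge
  | cons x l ih =>
    rw [List.prod_cons, List.length_cons, pow_succ']
    exact Submodule.mul_mem_mul (hl x List.mem_cons_self)
      (ih fun y hy => hl y (List.mem_cons_of_mem _ hy))

theorem dwedge_mem_pow {C : Set F} {r : ℕ} {s : Fin r → F} (hs : ∀ i, s i ∈ C) :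
    dwedge F s ∈ diffSpan C ^ r := by
  have := (diffSpan C).list_prod_mem_pow_length (l := List.ofFn fun i => dform F (s i)) fun x hx => by
    obtain ⟨i, rfl⟩ := (List.mem_ofFn' _ _).1 hx
    exact Submodule.subset_span ⟨s i, hs i, rfl⟩
  rwa [List.length_ofFn] at this

theorem mul_eq_zero_of_mem_pow {C : Set F} {r : ℕ} {ω : ExtOmega F}
    (hω : ∀ u ∈ dSet F fun _ : Fin r => C, ω * u = 0) {u : ExtOmega F}
    (hu : u ∈ diffSpan C ^ r) : ω * u = 0 := by
  rw [diffSpan, Submodule.span_pow] at hu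
  induction hu using Submodule.span_induction with
  | mem u hu =>
    obtain ⟨f, rfl⟩ := Set.mem_pow.1 hu
    choose s hs hsf using fun i => (f i).2
    refine hω _ ⟨s, hs, ?_⟩
    rw [dwedge]
    simp only [hsf]
  | zero => rw [mul_zero]
  | add x y _ _ hx hy => rw [mul_add, hx, hy, add_zero]
  | smul a x _ hx => rw [mul_smul_comm, hx, smul_zero]

theorem diffSpan_range_pow_eq_bot {k m : ℕ} (a : Fin k → F) (hm : k < m) :
    diffSpan (Set.range a) ^ m = ⊥ := by
  rw [diffSpan, Submodule.span_pow, Submodule.span_eq_bot]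
  intro u hu
  obtain ⟨f, rfl⟩ := Set.mem_pow.1 hu
  choose s hs hsf using fun i => (f i).2
  choose j hj using hs
  have h1 : (List.ofFn fun i => ((f i : _) : ExtOmega F)).prod =
      ExteriorAlgebra.ιMulti F m fun i => KaehlerDifferential.D ℤ F (a (j i)) := by
    rw [ExteriorAlgebra.ιMulti_apply]
    congr 2
    ext i
    rw [← hsf, ← hj]; rfl
  rw [h1]
  refine AlternatingMap.map_eq_zero_of_not_injective _ _ fun hinj => ?_
  have : Function.Injective j := fun x y hxy => hinj (by simp only [hxy])
  have := Fintype.card_le_of_injective j this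
  simp at this
  omega

theorem mem_OmegaPow_natCast {n : ℕ} {ω : ExtOmega F} :
    ω ∈ OmegaPow F n ↔ ω ∈ ⋀[F]^n (Ω[F⁄ℤ]) := by
  rw [OmegaPow, if_pos (Int.natCast_nonneg n), Int.toNat_natCast]

theorem ι_mul_eq_smul_mul_ι {n : ℕ} {ω : ExtOmega F} (hω : ω ∈ ⋀[F]^n (Ω[F⁄ℤ])) (v : Ω[F⁄ℤ]) :
    ExteriorAlgebra.ι F v * ω = (-1 : F) ^ n • (ω * ExteriorAlgebra.ι F v) := by
  induction hω using Submodule.pow_induction_on_left' with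
  | algebraMap r => simp [Algebra.commutes]
  | add x y i hx hy h1 h2 => rw [mul_add, h1, h2, add_mul, smul_add]
  | mem_mul m hm i x hx ih =>
    obtain ⟨w, rfl⟩ := hm
    rw [← mul_assoc, eq_neg_of_add_eq_zero_left (ExteriorAlgebra.ι_add_mul_swap v w), neg_mul,
      mul_assoc, ih, mul_smul_comm, pow_succ, mul_assoc]
    simp

theorem list_prod_mul_eq_smul {n : ℕ} {ω : ExtOmega F} (hω : ω ∈ ⋀[F]^n (Ω[F⁄ℤ]))
    (l : List (Ω[F⁄ℤ])) :
    (l.map (ExteriorAlgebra.ι F)).prod * ω =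
      (-1 : F) ^ (n * l.length) • (ω * (l.map (ExteriorAlgebra.ι F)).prod) := by
  induction l with
  | nil => simp
  | cons v l ih =>
    rw [List.map_cons, List.prod_cons, mul_assoc, ih, mul_smul_comm, ← mul_assoc,
      ι_mul_eq_smul_mul_ι hω, smul_mul_assoc, smul_smul, mul_assoc, List.length_cons, mul_add,
      mul_one, pow_add]

end DiffSpan

namespace IsDualSystem

variable {F : Type} [Field F] {N : ℕ} {b : ℕ → F}
  {D : ℕ → Derivation ℤ F F} (h : IsDualSystem N b D)
include h

theorem exists_fockRep_prod_dform {l : List ℕ} (hl : l.Nodup) (hN : ∀ i ∈ l, i < N)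
    (f : Finset ℕ → F) {I : Finset ℕ} (hI : ∀ i ∈ l, i ∉ I) :
    ∃ e : F, e ≠ 0 ∧
      fockRep N D (l.map fun i => dform F (b i)).prod f (l.toFinset ∪ I) = e * f I := by
  induction l with
  | nil => exact ⟨1, one_ne_zero, by simp⟩
  | cons i l ih =>
    rw [List.nodup_cons] at hl
    obtain ⟨e, he, hf⟩ := ih hl.2 (fun j hj => hN j (List.mem_cons_of_mem _ hj))
      (fun j hj => hI j (List.mem_cons_of_mem _ hj))
    have hi : i ∉ l.toFinset ∪ I := by
      rw [Finset.mem_union, List.mem_toFinset]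
      exact fun h' => h'.elim hl.1 (hI i List.mem_cons_self)
    refine ⟨b i * wedgeSign F i (insert i (l.toFinset ∪ I)) * e, mul_ne_zero (mul_ne_zero
      (h.ne_zero i (hN i List.mem_cons_self)) (wedgeSign_ne_zero _ _)) he, ?_⟩
    rw [List.map_cons, List.prod_cons, map_mul, Module.End.mul_apply,
      h.fockRep_dform_self (hN i List.mem_cons_self), List.toFinset_cons, Finset.insert_union,
      LinearMap.smul_apply, Pi.smul_apply, creation_apply, if_pos (Finset.mem_insert_self _ _),
      Finset.erase_insert hi, hf, smul_eq_mul]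
    ring

variable {p : ℕ} [hp : Fact p.Prime] [CharP F p]

theorem le_card_filter_of_mem_annOmega {n k r t : ℕ} (hkN : k ≤ N) (htr : t + r = k + 1)
    {S : Set F} (hS : genField F p b k ≤ pClosure F p S) {ω : ExtOmega F}
    (hω : ω ∈ annOmega F n (dSet F fun _ : Fin r => S)) {K : Finset ℕ}
    (hK : fock N D ω K ≠ 0) : t ≤ (K.filter (· < k)).card := by
  by_contra hlt
  rw [not_le] at hlt
  have hcard : r ≤ (Finset.range k \ K).card := by
    have h1 : Finset.range k ∩ K = K.filter (· < k) := by
      ext i; simp [and_comm]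
    have h2 := Finset.card_sdiff_add_card_inter (Finset.range k) K
    rw [h1, Finset.card_range] at h2
    omega
  obtain ⟨J, hJ, hJr⟩ := Finset.exists_subset_card_eq hcard
  have hJk : ∀ i ∈ J.toList, i < k ∧ i ∉ K := fun i hi => by
    simpa using hJ (Finset.mem_toList.1 hi)
  obtain ⟨e, he, hf⟩ := h.exists_fockRep_prod_dform J.nodup_toList
    (fun i hi => (hJk i hi).1.trans_le hkN) (fock N D ω) (fun i hi => (hJk i hi).2)
  obtain ⟨hΩ, hann⟩ := Submodule.mem_inf.1 hω
  have hann' : ∀ u ∈ dSet F fun _ : Fin r => S, ω * u = 0 := fun u hu => by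
    have := (Submodule.mem_iInf _).1 ((Submodule.mem_iInf _).1 hann u) hu
    exact this
  have hprod : (J.toList.map fun i => dform F (b i)).prod ∈ diffSpan S ^ r := by
    have := (diffSpan S).list_prod_mem_pow_length (l := J.toList.map fun i => dform F (b i))
      fun x hx => by
        obtain ⟨i, hi, rfl⟩ := List.mem_map.1 hx
        exact dform_mem_span (hS (mem_genField b (hJk i hi).1))
    rwa [List.length_map, Finset.length_toList, hJr] at this
  have h0 := list_prod_mul_eq_smul (mem_OmegaPow_natCast.1 hΩ)
    (J.toList.map fun i => KaehlerDifferential.D ℤ F (b i))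
  rw [List.map_map] at h0
  have h0' : (J.toList.map fun i => dform F (b i)).prod * ω = 0 := by
    refine h0.trans ?_
    have h3 := mul_eq_zero_of_mem_pow hann' hprod
    rw [show ω * (J.toList.map (ExteriorAlgebra.ι F ∘ fun i => KaehlerDifferential.D ℤ F (b i))).prod
      = 0 from h3, smul_zero]
  rw [← fock_mul, h0', map_zero, Pi.zero_apply] at hf
  exact mul_ne_zero he hK hf.symm

end IsDualSystem

section LogWedge

variable {F : Type} [Field F]

theorem nuPow_natCast (n : ℕ) : nuPow F n = logGroup (⊤ : Subfield F) n := by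
  rw [nuPow, if_pos (Int.natCast_nonneg n), logGroup, Int.toNat_natCast]
  congr 1
  ext ω
  constructor
  · rintro ⟨x, hx, rfl⟩
    refine ⟨List.ofFn x, List.length_ofFn, fun y hy => ?_, logForm_eq_dlogProd x⟩
    obtain ⟨i, rfl⟩ := (List.mem_ofFn' _ _).1 hy
    exact ⟨Subfield.mem_top _, hx i⟩
  · rintro ⟨l, rfl, hl, rfl⟩
    exact ⟨l.get, fun i => (hl _ (List.get_mem l i)).2, dlogProd_eq_logForm l⟩

theorem nuPow_of_neg {n : ℤ} (hn : n < 0) : nuPow F n = ⊥ := by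
  rw [nuPow, if_neg hn.not_ge]

theorem dlogProd_mem_exteriorPower (l : List F) : dlogProd l ∈ ⋀[F]^l.length (Ω[F⁄ℤ]) := by
  have := (LinearMap.range (ExteriorAlgebra.ι F (M := Ω[F⁄ℤ]))).list_prod_mem_pow_length
    (l := l.map dlog) fun x hx => by
      obtain ⟨i, _, rfl⟩ := List.mem_map.1 hx
      exact ⟨_, rfl⟩
  rwa [List.length_map] at this

theorem logGroup_le_exteriorPower (L : Subfield F) (n : ℕ) :
    logGroup L n ≤ (⋀[F]^n (Ω[F⁄ℤ])).toAddSubgroup := by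
  refine (AddSubgroup.closure_le _).2 ?_
  rintro _ ⟨l, rfl, -, rfl⟩
  exact dlogProd_mem_exteriorPower l

theorem nuPow_le_OmegaPow (n : ℕ) : nuPow F n ≤ (OmegaPow F n).toAddSubgroup := by
  intro ω hω
  rw [nuPow_natCast] at hω
  exact mem_OmegaPow_natCast.2 (logGroup_le_exteriorPower _ n hω)

theorem dlogProd_mul_mem_nuPow {l : List F} (hl : ∀ x ∈ l, x ≠ 0) {m : ℕ} {χ : ExtOmega F}
    (hχ : χ ∈ nuPow F m) : dlogProd l * χ ∈ nuPow F (l.length + m : ℕ) := by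
  rw [nuPow_natCast] at hχ ⊢
  induction hχ using AddSubgroup.closure_induction with
  | mem χ hχ =>
    obtain ⟨l', rfl, hl', rfl⟩ := hχ
    refine AddSubgroup.subset_closure ⟨l ++ l', by simp, fun x hx => ?_, (dlogProd_append _ _).symm⟩
    rcases List.mem_append.1 hx with hx | hx
    · exact ⟨Subfield.mem_top _, hl x hx⟩
    · exact hl' x hx
  | zero => rw [mul_zero]; exact zero_mem _
  | add x y _ _ hx hy => rw [mul_add]; exact add_mem hx hy
  | neg x _ hx => rw [mul_neg]; exact neg_mem hx

theorem annNu_eq_nuPow {n : ℕ} {U : Set (ExtOmega F)} (hU : ∀ u ∈ U, u = 0) :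
    annNu F n U = nuPow F n := by
  refine inf_eq_right.2 fun ω hω => ?_
  refine Submodule.mem_inf.2 ⟨nuPow_le_OmegaPow n hω, ?_⟩
  simp only [Submodule.mem_iInf]
  intro u hu
  rw [hU u hu]
  simp

variable {p : ℕ} [hp : Fact p.Prime] [CharP F p]

theorem diffSpan_mono_of_subset {C C' : Set F} (hC : C ⊆ pClosure F p C') :
    diffSpan C ≤ diffSpan C' := by
  refine Submodule.span_le.2 ?_
  rintro _ ⟨x, hx, rfl⟩
  exact dform_mem_span (hC hx)

theorem logWedgeNu_le_annNu {n k r t : ℕ} {m : ℤ} (hn : (n : ℤ) = t + m) (htr : t + r = k + 1)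
    {S : Set F} (a : Fin k → F) (ha : pClosure F p (Set.range a) = pClosure F p S) :
    logWedgeNu F (pClosure F p (Set.range a)) t m ≤ annNu F n (dSet F fun _ : Fin r => S) := by
  refine (AddSubgroup.closure_le _).2 ?_
  rintro _ ⟨y, hy, χ, hχ, rfl⟩
  rcases lt_or_ge m 0 with hm | hm
  · rw [nuPow_of_neg hm, AddSubgroup.mem_bot] at hχ
    rw [hχ, mul_zero]
    exact zero_mem _
  obtain ⟨m, rfl⟩ := Int.eq_ofNat_of_zero_le hm
  obtain rfl : n = t + m := by exact_mod_cast hn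
  rw [logForm_eq_dlogProd]
  have hyl : ∀ x ∈ List.ofFn y, x ∈ pClosure F p (Set.range a) ∧ x ≠ 0 := fun x hx => by
    obtain ⟨i, rfl⟩ := (List.mem_ofFn' _ _).1 hx
    exact hy i
  have hν := dlogProd_mul_mem_nuPow (fun x hx => (hyl x hx).2) hχ
  rw [List.length_ofFn] at hν
  refine ⟨Submodule.mem_inf.2 ⟨nuPow_le_OmegaPow _ hν, ?_⟩, hν⟩
  simp only [Submodule.mem_iInf]
  rintro _ ⟨s, hs, rfl⟩
  have hχ' : χ ∈ ⋀[F]^m (Ω[F⁄ℤ]) := mem_OmegaPow_natCast.1 (nuPow_le_OmegaPow m hχ)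
  have hcomm := list_prod_mul_eq_smul hχ' (List.ofFn fun i => KaehlerDifferential.D ℤ F (s i))
  rw [List.map_ofFn] at hcomm
  change dwedge F s * χ = _ • (χ * dwedge F s) at hcomm
  have h1 : dlogProd (List.ofFn y) ∈ diffSpan (Set.range a) ^ t := by
    have := (diffSpan (Set.range a)).list_prod_mem_pow_length (l := (List.ofFn y).map dlog)
      fun x hx => by
        obtain ⟨z, hz, rfl⟩ := List.mem_map.1 hx
        rw [dlog_eq_smul]
        exact Submodule.smul_mem _ _ (dform_mem_span (hyl z hz).1)
    rwa [List.length_map, List.length_ofFn] at this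
  have h2 : dwedge F s ∈ diffSpan (Set.range a) ^ r :=
    pow_le_pow_left' (diffSpan_mono_of_subset (ha ▸ subset_pClosure S)) r (dwedge_mem_pow hs)
  have h3 : dlogProd (List.ofFn y) * dwedge F s = 0 := by
    have := Submodule.mul_mem_mul h1 h2
    rwa [← pow_add, diffSpan_range_pow_eq_bot a (by omega), Submodule.mem_bot] at this
  have h4 : dlogProd (List.ofFn y) * (dwedge F s * χ) = 0 := by rw [← mul_assoc, h3, zero_mul]
  rw [hcomm, mul_smul_comm, smul_eq_zero] at h4
  rw [LinearMap.mem_ker, LinearMap.mulRight_apply, mul_assoc]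
  exact h4.resolve_left (pow_ne_zero _ (neg_ne_zero.2 one_ne_zero))

end LogWedge

section ExistsDerivation

variable {F : Type} [Field F] {p : ℕ} [hp : Fact p.Prime] [CharP F p]

open Polynomial in
theorem Subfield.minpoly_eq_X_pow_sub_C {M : Subfield F} (hM : ∀ y : F, y ^ p ∈ M) {x : F}
    (hx : x ∉ M) : minpoly M x = X ^ p - C ⟨x ^ p, hM x⟩ := by
  refine (minpoly.eq_of_irreducible_of_monic (X_pow_sub_C_irreducible_of_prime hp.out ?_) ?_
    (monic_X_pow_sub_C _ hp.out.ne_zero)).symm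
  · intro b hb
    have h : (b : F) ^ p = x ^ p := congrArg Subtype.val hb
    exact hx (frobenius_inj F p h ▸ b.2)
  · simp only [map_sub, map_pow, aeval_X, aeval_C]
    exact sub_self _

theorem Subfield.finrank_adjoin_simple_eq {M : Subfield F} (hM : ∀ y : F, y ^ p ∈ M) {x : F}
    (hx : x ∉ M) : Module.finrank M (IntermediateField.adjoin M {x}) = p := by
  have hintegral : IsIntegral M x := IsIntegral.of_pow hp.out.pos
    (isIntegral_algebraMap (x := (⟨x ^ p, hM x⟩ : M)))
  rw [IntermediateField.adjoin.finrank hintegral, Subfield.minpoly_eq_X_pow_sub_C hM hx,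
    Polynomial.natDegree_X_pow_sub_C]

theorem Subfield.exists_maximal_notMem {M₀ : Subfield F} {x : F} (hx : x ∉ M₀) :
    ∃ M, M₀ ≤ M ∧ Maximal (fun M : Subfield F => M₀ ≤ M ∧ x ∉ M) M := by
  refine zorn_le_nonempty₀ {M : Subfield F | M₀ ≤ M ∧ x ∉ M} (fun c hc hch y hy => ?_) M₀ ⟨le_rfl, hx⟩
  refine ⟨sSup c, ⟨(hc hy).1.trans (le_sSup hy), fun hmem => ?_⟩, fun z hz => le_sSup hz⟩
  obtain ⟨K, hK, hxK⟩ := (Subfield.mem_sSup_of_directedOn ⟨y, hy⟩ hch.directedOn).1 hmem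
  exact (hc hK).2 hxK

/-- An element outside of a subfield containing all `p`-th powers is detected by a derivation
vanishing on that subfield. -/
theorem exists_derivation_apply_eq_one {M₀ : Subfield F} (hM₀ : ∀ y : F, y ^ p ∈ M₀) {x : F}
    (hx : x ∉ M₀) : ∃ d : Derivation ℤ F F, (∀ y ∈ M₀, d y = 0) ∧ d x = 1 := by
  obtain ⟨M, hle, ⟨-, hxM⟩, hmax⟩ := Subfield.exists_maximal_notMem hx
  have hM : ∀ y : F, y ^ p ∈ M := fun y => hle (hM₀ y)
  have hintegral : ∀ y : F, IsIntegral M y := fun y => IsIntegral.of_pow hp.out.pos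
    (isIntegral_algebraMap (x := (⟨y ^ p, hM y⟩ : M)))
  have htop : IntermediateField.adjoin M {x} = ⊤ := by
    refine eq_top_iff.2 fun w _ => ?_
    by_cases hw : w ∈ M
    · exact (IntermediateField.adjoin M {x}).algebraMap_mem ⟨w, hw⟩
    have hxw : x ∈ IntermediateField.adjoin M {w} := by
      by_contra hxw
      have := hmax (y := (IntermediateField.adjoin M {w}).toSubfield)
        ⟨fun y hy => (IntermediateField.adjoin M {w}).algebraMap_mem ⟨y, hle hy⟩, hxw⟩
        (fun y hy => (IntermediateField.adjoin M {w}).algebraMap_mem ⟨y, hy⟩)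
      exact hw (this (IntermediateField.mem_adjoin_simple_self M w))
    have hfin : FiniteDimensional M (IntermediateField.adjoin M {w}) :=
      IntermediateField.adjoin.finiteDimensional (hintegral w)
    have := IntermediateField.eq_of_le_of_finrank_eq
      (IntermediateField.adjoin_simple_le_iff.2 hxw)
      ((Subfield.finrank_adjoin_simple_eq hM hxM).trans (Subfield.finrank_adjoin_simple_eq hM hw).symm)
    rw [this]
    exact IntermediateField.mem_adjoin_simple_self M w
  have hfin : FiniteDimensional M F := by
    have := IntermediateField.adjoin.finiteDimensional (hintegral x)
    rw [htop] at this
    exact Module.Finite.equiv (IntermediateField.topEquiv (F := M) (E := F)).toLinearEquiv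
  have hns : ¬ Algebra.IsSeparable M F := fun hs => by
    have h1 : (minpoly M x).Separable := hs.isSeparable' x
    rw [Subfield.minpoly_eq_X_pow_sub_C hM hxM] at h1
    have : (p : M) = 0 := Subtype.ext (by simp)
    rw [Polynomial.separable_def] at h1
    simp only [Polynomial.derivative_sub, Polynomial.derivative_X_pow, this, Polynomial.derivative_C,
      map_zero, zero_mul, sub_zero, isCoprime_zero_right] at h1
    have h2 := Polynomial.natDegree_eq_zero_of_isUnit h1
    rw [Polynomial.natDegree_X_pow_sub_C] at h2
    exact hp.out.ne_zero h2
  have hnt : Nontrivial (Ω[F⁄M]) := by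
    by_contra hnt
    rw [not_nontrivial_iff_subsingleton] at hnt
    exact hns ((Algebra.FormallyUnramified.iff_isSeparable M F).1 ⟨hnt⟩)
  have hDx : KaehlerDifferential.D M F x ≠ 0 := fun h0 => by
    have : KaehlerDifferential.D M F = 0 := by
      refine Derivation.ext_of_adjoin_eq_top {x} ?_ ?_
      · rw [← IntermediateField.adjoin_simple_toSubalgebra_of_isAlgebraic (hintegral x).isAlgebraic, htop]
        rfl
      · rintro _ rfl
        simpa using h0
    obtain ⟨z, hz⟩ := exists_ne (0 : Ω[F⁄M])
    have hz' : z ∈ Submodule.span F (Set.range (KaehlerDifferential.D M F)) := by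
      rw [KaehlerDifferential.span_range_derivation]; trivial
    rw [this] at hz'
    refine hz ((Submodule.mem_bot F).1 ((Submodule.span_le.2 ?_ :
      Submodule.span F (Set.range (0 : Derivation M F (Ω[F⁄M]))) ≤ ⊥) hz'))
    rintro _ ⟨y, rfl⟩
    simp
  obtain ⟨f, hf⟩ := Module.Projective.exists_dual_ne_zero F hDx
  refine ⟨(f (KaehlerDifferential.D M F x))⁻¹ •
    (f.compDer (KaehlerDifferential.D M F)).restrictScalars ℤ, fun y hy => ?_, ?_⟩
  · have : KaehlerDifferential.D M F y = 0 :=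
      (KaehlerDifferential.D M F).map_algebraMap (⟨y, hle hy⟩ : M)
    simp [this]
  · simp [hf]

end ExistsDerivation

namespace IsDualSystem

variable {F : Type} [Field F] {p : ℕ} [hp : Fact p.Prime] [CharP F p] {N : ℕ} {b : ℕ → F}
  {D : ℕ → Derivation ℤ F F}

theorem exists_extend_one (h : IsDualSystem N b D) {x : F} (hx : x ∉ genField F p b N) :
    ∃ b' D', IsDualSystem (N + 1) b' D' ∧ (∀ i < N, b' i = b i) ∧ b' N = x := by
  obtain ⟨d, hd, hdx⟩ := exists_derivation_apply_eq_one (pow_mem_genField b N) hx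
  have hdb : ∀ i < N, d (b i) = 0 := fun i hi => hd _ (mem_genField b hi)
  refine ⟨Function.update b N x,
    fun i => if i < N then D i - D i x • d else if i = N then x • d else 0,
    ⟨fun i hi => ?_, fun i j hj hij => ?_, fun i hi => ?_, fun i hi => ?_⟩,
    fun i hi => Function.update_of_ne hi.ne _ _, Function.update_self _ _ _⟩
  · rcases Nat.lt_succ_iff_lt_or_eq.1 hi with hi | rfl
    · simp [hi, hi.ne, hdb i hi, h.apply_self i hi]
    · simp [hdx]
  · rcases Nat.lt_succ_iff_lt_or_eq.1 hj with hj | rfl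
    · rw [Function.update_of_ne hj.ne]
      split_ifs with h1 h2
      · simp [hdb j hj, h.apply_ne i j hj hij]
      · simp [hdb j hj]
      · rfl
    · rw [Function.update_self]
      split_ifs with h1
      · simp [hdx]
      · rfl
  · rcases Nat.lt_succ_iff_lt_or_eq.1 hi with hi | rfl
    · rw [Function.update_of_ne hi.ne]
      exact h.ne_zero i hi
    · rw [Function.update_self]
      rintro rfl
      exact hx (zero_mem _)
  · simp [show ¬ i < N by omega, show i ≠ N by omega]

omit hp [CharP F p] in
theorem genField_congr {b b' : ℕ → F} {s : ℕ} (hb : ∀ i < s, b' i = b i) :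
    genField F p b' s = genField F p b s := by
  rw [genField, genField, Set.image_congr (s := Set.Iio s) (f := b') (g := b) hb]

theorem exists_extend (h : IsDualSystem N b D) (xs : List F) :
    ∃ N' b' D', IsDualSystem N' b' D' ∧ N ≤ N' ∧ N' ≤ N + xs.length ∧ (∀ i < N, b' i = b i) ∧
      (∀ x ∈ xs, x ∈ genField F p b' N') ∧
      ∀ K : Subfield F, genField F p b N ≤ K → (∀ x ∈ xs, x ∈ K) → genField F p b' N' ≤ K := by
  induction xs with
  | nil => exact ⟨N, b, D, h, le_rfl, le_rfl, fun _ _ => rfl, by simp, fun K hK _ => hK⟩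
  | cons x xs ih =>
    obtain ⟨M, c, E, hE, hNM, hM, hcb, hc, hK⟩ := ih
    by_cases hx : x ∈ genField F p c M
    · refine ⟨M, c, E, hE, hNM, hM.trans (by simp), hcb, List.forall_mem_cons.2 ⟨hx, hc⟩,
        fun K h1 h2 => hK K h1 fun y hy => h2 y (List.mem_cons_of_mem _ hy)⟩
    · obtain ⟨c', E', hE', hcc, hcx⟩ := hE.exists_extend_one hx
      have hcongr := genField_congr (p := p) hcc
      have hle : genField F p c M ≤ genField F p c' (M + 1) :=
        hcongr ▸ genField_mono c' M.le_succ
      refine ⟨M + 1, c', E', hE', by omega, by simp; omega,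
        fun i hi => (hcc i (by omega)).trans (hcb i hi), List.forall_mem_cons.2
          ⟨hcx ▸ mem_genField c' M.lt_succ_self, fun y hy => hle (hc y hy)⟩, fun K h1 h2 => ?_⟩
      have h3 := hK K h1 fun y hy => h2 y (List.mem_cons_of_mem _ hy)
      refine pClosure_le (fun y => h3 (pow_mem_genField c M y)) ?_
      rintro _ ⟨i, hi, rfl⟩
      rcases Nat.lt_succ_iff_lt_or_eq.1 hi with hi | rfl
      · rw [hcc i hi]
        exact h3 (mem_genField c hi)
      · rw [hcx]
        exact h2 x List.mem_cons_self

omit hp [CharP F p] in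
theorem zero (b : ℕ → F) : IsDualSystem 0 b 0 :=
  ⟨by simp, by simp, by simp, fun _ _ => rfl⟩

end IsDualSystem

section Degree

variable {F : Type} [Field F] {p : ℕ} [hp : Fact p.Prime] [CharP F p]

theorem mem_span_monomials (b : ℕ → F) (s : ℕ) {x : F} (hx : x ∈ genField F p b s) :
    x ∈ Submodule.span (pClosure F p ∅)
      (Set.range fun m : Fin s → Fin p => ∏ i : Fin s, b i ^ (m i : ℕ)) := by
  refine genField_induction (fun y m => ?_) (fun x y _ _ hx hy => add_mem hx hy) hx
  have : y ^ p * ∏ i ∈ Finset.range s, b i ^ m i =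
      (⟨(y * ∏ i ∈ Finset.range s, b i ^ (m i / p)) ^ p, pow_mem_pClosure _ _⟩ : pClosure F p ∅) •
        ∏ i : Fin s, b i ^ (m i % p) := by
    rw [Subfield.smul_def, Fin.prod_univ_eq_prod_range (fun i => b i ^ (m i % p)), smul_eq_mul]
    change _ = (y * ∏ i ∈ Finset.range s, b i ^ (m i / p)) ^ p * _
    rw [mul_pow, mul_assoc, ← Finset.prod_pow, ← Finset.prod_mul_distrib]
    congr 1
    refine Finset.prod_congr rfl fun i _ => ?_
    rw [← pow_mul, ← pow_add, mul_comm, Nat.div_add_mod]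
  rw [this]
  exact Submodule.smul_mem _ _ (Submodule.subset_span
    ⟨fun i => ⟨m i % p, Nat.mod_lt _ hp.out.pos⟩, rfl⟩)

theorem relDeg_le_pow (b : ℕ → F) (s : ℕ) {C : Set F} (hC : C ⊆ genField F p b s) :
    relDeg F (pClosure F p ∅) C ≤ p ^ s := by
  have hle : (IntermediateField.adjoin (pClosure F p ∅) C).toSubfield ≤ genField F p b s := by
    refine Subfield.closure_le.2 (Set.union_subset ?_ hC)
    rintro _ ⟨y, rfl⟩
    exact pClosure_mono (Set.empty_subset _) y.2
  have hle' : Subalgebra.toSubmodule (IntermediateField.adjoin (pClosure F p ∅) C).toSubalgebra ≤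
      Submodule.span (pClosure F p ∅)
        (Set.range fun m : Fin s → Fin p => ∏ i : Fin s, b i ^ (m i : ℕ)) :=
    fun x hx => mem_span_monomials b s (hle hx)
  have := FiniteDimensional.span_of_finite (pClosure F p ∅)
    (Set.finite_range fun m : Fin s → Fin p => ∏ i : Fin s, b i ^ (m i : ℕ))
  refine (Submodule.finrank_mono hle').trans ((finrank_range_le_card _).trans ?_)
  rw [Fintype.card_fun, Fintype.card_fin, Fintype.card_fin]

/-- A `p`-basis generates the same field as the first `k` members of a dual system. -/
theorem exists_isDualSystem {k : ℕ} {a : Fin k → F} (ha : pIndep F p a) :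
    ∃ b D, IsDualSystem k b D ∧ genField F p b k = pClosure F p (Set.range a) := by
  obtain ⟨N, b, D, h, -, hN, -, hmem, hle⟩ :=
    (IsDualSystem.zero (0 : ℕ → F)).exists_extend (p := p) (List.ofFn a)
  have hsub : Set.range a ⊆ genField F p b N := by
    rintro _ ⟨i, rfl⟩
    exact hmem _ ((List.mem_ofFn' _ _).2 ⟨i, rfl⟩)
  have hk : k ≤ N := (Nat.pow_le_pow_iff_right hp.out.one_lt).1
    ((ha : relDeg F _ _ = _) ▸ relDeg_le_pow b N hsub)
  obtain rfl : N = k := le_antisymm (by simpa using hN) hk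
  refine ⟨b, D, h, le_antisymm (hle _ ?_ fun x hx => ?_) (pClosure_le (pow_mem_genField b N) hsub)⟩
  · exact pClosure_le (pow_mem_pClosure _) (by simp)
  · obtain ⟨i, rfl⟩ := (List.mem_ofFn' _ _).1 hx
    exact subset_pClosure _ ⟨i, rfl⟩

theorem exists_list_mem_logGroup {n : ℕ} {ω : ExtOmega F} (hω : ω ∈ nuPow F n) :
    ∃ xs : List F, ∀ L : Subfield F, (∀ x ∈ xs, x ∈ L) → ω ∈ logGroup L n := by
  rw [nuPow_natCast] at hω
  induction hω using AddSubgroup.closure_induction with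
  | mem ω hω =>
    obtain ⟨l, hn, hl, rfl⟩ := hω
    exact ⟨l, fun L hL => AddSubgroup.subset_closure
      ⟨l, hn, fun x hx => ⟨hL x hx, (hl x hx).2⟩, rfl⟩⟩
  | zero => exact ⟨[], fun L _ => zero_mem _⟩
  | add x y _ _ hx hy =>
    obtain ⟨xs, hxs⟩ := hx
    obtain ⟨ys, hys⟩ := hy
    exact ⟨xs ++ ys, fun L hL => add_mem (hxs L fun z hz => hL z (List.mem_append_left _ hz))
      (hys L fun z hz => hL z (List.mem_append_right _ hz))⟩
  | neg x _ hx =>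
    obtain ⟨xs, hxs⟩ := hx
    exact ⟨xs, fun L hL => neg_mem (hxs L hL)⟩

theorem dlogProd_append_mem_logWedgeNu {K : Subfield F} {t n : ℕ} {l l' : List F}
    (hl : ∀ x ∈ l, x ∈ K ∧ x ≠ 0) (hl' : ∀ x ∈ l', x ≠ 0) (hn : l.length + l'.length = n)
    (ht : t ≤ l.length) : dlogProd (l ++ l') ∈ logWedgeNu F K t ((n : ℤ) - t) := by
  have hlen : (l.take t).length = t := List.length_take_of_le ht
  have hm : (n : ℤ) - t = ((l.drop t ++ l').length : ℕ) := by
    rw [List.length_append, List.length_drop]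
    omega
  have hval : ∀ m (e : m = (l.drop t ++ l').length), dlogProd (l.drop t ++ l') ∈ nuPow F (m : ℕ) := by
    rintro _ rfl
    rw [nuPow_natCast]
    refine AddSubgroup.subset_closure ⟨_, rfl, fun x hx => ⟨Subfield.mem_top _, ?_⟩, rfl⟩
    rcases List.mem_append.1 hx with hx | hx
    · exact (hl x (List.mem_of_mem_drop hx)).2
    · exact hl' x hx
  have hform : ∃ y : Fin t → F, (∀ i, y i ∈ K ∧ y i ≠ 0) ∧ logForm F y = dlogProd (l.take t) := by
    have : ∀ l₀ : List F, l₀.length = t → (∀ x ∈ l₀, x ∈ K ∧ x ≠ 0) →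
        ∃ y : Fin t → F, (∀ i, y i ∈ K ∧ y i ≠ 0) ∧ logForm F y = dlogProd l₀ := by
      rintro l₀ rfl h0
      exact ⟨l₀.get, fun i => h0 _ (List.get_mem _ _), (dlogProd_eq_logForm l₀).symm⟩
    exact this _ hlen fun x hx => hl x (List.mem_of_mem_take hx)
  obtain ⟨y, hy, hyl⟩ := hform
  refine AddSubgroup.subset_closure ⟨y, hy, dlogProd (l.drop t ++ l'), hm ▸ hval _ rfl, ?_⟩
  rw [hyl, ← dlogProd_append, ← List.append_assoc, List.take_append_drop]

end Degree

/-- Theorem 4.3(b). Assume `F^{p−1} = F`; let `S ⊆ F` be nonempty with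
`pdeg S = k` and `{a₁,…,a_k}` a `p`-basis of `F^p(S)`. For `r ∈ {1,…,k}` and `t = k − r + 1`:
`ann ν^n_F(⋀^r dS) = [dy₁/y₁ ∧ … ∧ dy_t/y_t ∣ yᵢ ∈ F^p(a₁,…,a_k)^*] ∧ ν_{n−t}(F)`;
for `r > k`, `ann ν^n_F(⋀^r dS) = ν_n(F)`. -/
theorem stmt13 (F : Type) [Field F] (p : ℕ) [Fact p.Prime] [CharP F p]
    (hF : ∀ x : F, ∃ y : F, y ^ (p - 1) = x)
    (n k : ℕ) (S : Set F) (hS : S.Nonempty) (hdeg : pDegEq F p S k)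
    (a : Fin k → F) (ha : pIndep F p a)
    (hgen : pClosure F p (Set.range a) = pClosure F p S) (r : ℕ) :
    (1 ≤ r → r ≤ k →
      annNu F n (dSet F fun _ : Fin r => S) =
        logWedgeNu F (pClosure F p (Set.range a)) (k - r + 1)
          ((n : ℤ) - (k - r + 1))) ∧
    (k < r → annNu F n (dSet F fun _ : Fin r => S) = nuPow F n) := by
  refine ⟨fun hr hrk => ?_, fun hkr => annNu_eq_nuPow ?_⟩
  · have hcast : (n : ℤ) - (k - r + 1) = n - ((k - r + 1 : ℕ) : ℤ) := by
      push_cast [Nat.cast_sub hrk]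
      rfl
    have htr : k - r + 1 + r = k + 1 := by omega
    rw [hcast]
    have hge := logWedgeNu_le_annNu (p := p) (n := n) (r := r) (t := k - r + 1)
      (m := (n : ℤ) - ((k - r + 1 : ℕ) : ℤ)) (by ring) htr a hgen
    refine le_antisymm (fun ω hω => ?_) hge
    obtain ⟨b₀, D₀, h₀, hb₀⟩ := exists_isDualSystem ha
    obtain ⟨xs, hxs⟩ := exists_list_mem_logGroup hω.2
    obtain ⟨N, b, D, h, hkN, -, hbb, hmem, -⟩ := h₀.exists_extend (p := p) xs
    have hbk : genField F p b k = pClosure F p (Set.range a) :=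
      (IsDualSystem.genField_congr hbb).trans hb₀
    refine h.mem_of_dlogProd_mem (p := p) hF (k := k)
      (A := annNu F n (dSet F fun _ : Fin r => S))
      (fun η hη _ K hK => h.le_card_filter_of_mem_annOmega (p := p) hkN htr (hbk.trans hgen).le hη.1 hK)
      hge (fun l l' hn ht hl hl' => ?_) hω (hxs _ hmem)
    exact dlogProd_append_mem_logWedgeNu (fun x hx => hbk ▸ hl x hx) hl' hn ht
  · rintro _ ⟨s, hs, rfl⟩
    have h2 := pow_le_pow_left' (diffSpan_mono_of_subset (p := p)
      (hgen ▸ subset_pClosure S : S ⊆ pClosure F p (Set.range a))) r (dwedge_mem_pow hs)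
    rwa [diffSpan_range_pow_eq_bot a hkr, Submodule.mem_bot] at h2
end

section
/- Let F be a field of characteristic p > 0, let {b_1, ..., b_r} ⊆ F be p-independent, let m_1, ..., m_r ∈ ℕ, and let E = F(b_1^{1/p^{m_1}}, ..., b_r^{1/p^{m_r}}) inside an algebraic closure of F. Then Ω^n(E/F) = Σ_{i=1}^r d b_i ∧ Ω^{n−1}(F) = annΩ^n_F(d b_1 ∧ ... ∧ d b_r), and ν_n(E/F) = ann ν^n_F(d b_1 ∧ ... ∧ d b_r). -/
set_option synthInstance.maxHeartbeats 1000000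
set_option maxHeartbeats 1000000

open ExteriorAlgebra

section FieldTheory
open Polynomial

theorem minpoly_eq_X_pow_char_pow_sub_C {K L : Type*} [Field K] [Field L] [Algebra K L]
    {p : ℕ} [Fact p.Prime] [CharP K p] {m : ℕ} {β : L} {c : K}
    (hβ : β ^ p ^ m = algebraMap K L c) (hc : ∀ y : K, y ^ p ≠ c) :
    minpoly K β = X ^ p ^ m - C c := by
  have hp : p.Prime := Fact.out
  have : ExpChar K p := .prime hp
  obtain ⟨n, y, hn⟩ := (minpoly.natSepDegree_eq_one_iff_eq_X_pow_sub_C p).1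
    ((minpoly.natSepDegree_eq_one_iff_pow_mem p (x := β)).2 ⟨m, c, hβ.symm⟩)
  have hy : β ^ p ^ n = algebraMap K L y := by
    have := minpoly.aeval K β
    rw [hn] at this
    simpa [sub_eq_zero] using this
  have hle : n ≤ m := by
    have hdvd : minpoly K β ∣ X ^ p ^ m - C c := minpoly.dvd K β (by simp [hβ])
    have := natDegree_le_of_dvd hdvd (X_pow_sub_C_ne_zero (pow_pos hp.pos m) c)
    rw [hn, natDegree_X_pow_sub_C, natDegree_X_pow_sub_C] at this
    exact (Nat.pow_le_pow_iff_right hp.one_lt).1 this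
  obtain ⟨k, rfl⟩ := Nat.exists_eq_add_of_le hle
  have hyc : y ^ p ^ k = c := by
    apply (algebraMap K L).injective
    rw [map_pow, ← hy, ← pow_mul, ← pow_add, hβ]
  cases k with
  | zero => rw [hn, ← hyc]; simp
  | succ k => exact absurd (by rw [← pow_mul, ← pow_succ, hyc]) (hc (y ^ p ^ k))

open IntermediateField in
theorem exists_ringHom_adjoin_simple {K L T : Type*} [Field K] [Field L] [Algebra K L] [CommRing T]
    {p : ℕ} [Fact p.Prime] [CharP K p] (π : T →+* L) (φ : K →+* T)
    (hφ : ∀ x, π (φ x) = algebraMap K L x) {m : ℕ} {β : L} {c : K}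
    (hβ : β ^ p ^ m = algebraMap K L c) (hc : ∀ y : K, y ^ p ≠ c)
    (y : T) (hy : π y = β) (hyc : y ^ p ^ m = φ c) :
    ∃ ψ : K⟮β⟯ →+* T, (∀ x, π (ψ x) = x) ∧ (∀ x, ψ (algebraMap K _ x) = φ x) ∧
      ψ (AdjoinSimple.gen K β) = y := by
  have hp : p.Prime := Fact.out
  let := φ.toAlgebra
  let π' : T →ₐ[K] L := { π with commutes' := hφ }
  have hmin := minpoly_eq_X_pow_char_pow_sub_C hβ hc
  have hint : IsIntegral K β :=
    ⟨X ^ p ^ m - C c, monic_X_pow_sub_C c (pow_pos hp.pos m).ne', by simp [hβ]⟩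
  let pb := adjoin.powerBasis hint
  have hgen : pb.gen = AdjoinSimple.gen K β := adjoin.powerBasis_gen hint
  have hroot : aeval y (minpoly K pb.gen) = 0 := by
    rw [hgen, minpoly_gen, hmin]
    simp [hyc, RingHom.algebraMap_toAlgebra]
  let ψ := pb.lift y hroot
  have hψ : ψ pb.gen = y := pb.lift_gen y hroot
  have hcomp : π'.comp ψ = K⟮β⟯.val := by
    apply pb.algHom_ext
    rw [AlgHom.comp_apply, hψ, hgen]
    exact hy
  exact ⟨ψ, fun x => DFunLike.congr_fun hcomp x, fun x => ψ.commutes x, by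
    rw [← hgen]; exact hψ⟩

open IntermediateField in
theorem finrank_adjoin_image_le_pow {B L ι : Type*} [Field B] [Field L] [Algebra B L] {p : ℕ}
    (hp : 0 < p) (b : ι → L) (s : Finset ι) (hb : ∀ i ∈ s, b i ^ p ∈ Set.range (algebraMap B L)) :
    Module.finrank B (adjoin B (b '' s)) ≤ p ^ s.card := by
  classical
  induction s using Finset.induction_on with
  | empty => rw [Finset.coe_empty, Set.image_empty, adjoin_empty, IntermediateField.finrank_bot]; simp
  | insert i s hi ih =>
    rw [Finset.coe_insert, Set.image_insert_eq, Set.insert_eq, adjoin_union,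
      Finset.card_insert_of_notMem hi, pow_succ']
    refine (finrank_sup_le _ _).trans (Nat.mul_le_mul ?_ ?_)
    · obtain ⟨c, hc⟩ := hb i (by simp)
      have haeval : aeval (b i) (X ^ p - C c) = 0 := by simp [hc]
      rw [adjoin.finrank ⟨_, monic_X_pow_sub_C c hp.ne', by simp [hc]⟩]
      simpa using natDegree_le_of_dvd (minpoly.dvd B (b i) haeval) (X_pow_sub_C_ne_zero hp c)
    · exact ih fun j hj => hb j (by simp [hj])

open IntermediateField in
/-- An element outside an intermediate field `N₀` lies outside some maximal such `N`, and then
generates the whole extension over `N`, provided all `p`-th powers lie in the base. -/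
theorem exists_intermediateField_adjoin_simple_eq_top {B L : Type*} [Field B] [Field L]
    [Algebra B L] {p : ℕ} [Fact p.Prime] [CharP L p]
    (hB : ∀ x : L, x ^ p ∈ Set.range (algebraMap B L))
    (N₀ : IntermediateField B L) (x : L) (hx : x ∉ N₀) :
    ∃ N : IntermediateField B L, N₀ ≤ N ∧ x ∉ N ∧ N⟮x⟯ = ⊤ := by
  have hp : p.Prime := Fact.out
  obtain ⟨N, hN₀, hN⟩ := zorn_le_nonempty₀ {N : IntermediateField B L | x ∉ N}
    (fun c hc hchain N hN => by
      refine ⟨sSup c, ?_, fun z hz => le_sSup hz⟩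
      intro hmem
      have := (CompleteLattice.isCompactElement_iff_le_of_directed_sSup_le _ _).1
        (adjoin_simple_isCompactElement (F := B) x) c ⟨N, hN⟩ hchain.directedOn
        (adjoin_simple_le_iff.2 hmem)
      obtain ⟨z, hz, hxz⟩ := this
      exact hc hz (adjoin_simple_le_iff.1 hxz)) N₀ hx
  refine ⟨N, hN₀, hN.prop, ?_⟩
  have hpow : ∀ z : L, ∃ c : N, z ^ p ^ 1 = algebraMap N L c := fun z => by
    obtain ⟨c, hc⟩ := hB z
    exact ⟨algebraMap B N c, by rw [pow_one, ← hc]; rfl⟩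
  have : CharP N p := (algebraMap N L).charP (algebraMap N L).injective p
  have hmin : ∀ z : L, z ∉ N → IsIntegral N z ∧ Module.finrank N N⟮z⟯ = p := fun z hz => by
    obtain ⟨c, hc⟩ := hpow z
    have hint : IsIntegral N z :=
      ⟨X ^ p ^ 1 - C c, monic_X_pow_sub_C c (pow_pos hp.pos 1).ne', by
        rw [eval₂_sub, eval₂_X_pow, eval₂_C, hc, sub_self]⟩
    have hc' : ∀ y : N, y ^ p ≠ c := by
      rintro y rfl
      apply hz
      have : z = y := frobenius_inj L p (by simpa [frobenius_def] using hc)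
      rw [this]; exact y.2
    refine ⟨hint, ?_⟩
    rw [adjoin.finrank hint, minpoly_eq_X_pow_char_pow_sub_C hc hc', natDegree_X_pow_sub_C, pow_one]
  rw [eq_top_iff]
  intro y _
  by_cases hy : y ∈ N
  · exact N⟮x⟯.algebraMap_mem ⟨y, hy⟩
  · have hxy : x ∈ N⟮y⟯ := by
      by_contra h
      have h1 : N ≤ N⟮y⟯.restrictScalars B := fun z hz => N⟮y⟯.algebraMap_mem ⟨z, hz⟩
      exact hy (hN.le_of_ge (y := N⟮y⟯.restrictScalars B) h h1 (mem_adjoin_simple_self N y))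
    have : FiniteDimensional N N⟮y⟯ := adjoin.finiteDimensional (hmin y hy).1
    have heq : N⟮x⟯ = N⟮y⟯ := eq_of_le_of_finrank_eq (adjoin_simple_le_iff.2 hxy)
      (by rw [(hmin y hy).2, (hmin x hN.prop).2])
    rw [heq]; exact mem_adjoin_simple_self N y

end FieldTheory

section Derivations
open TrivSqZeroExt

/-- The derivation given by the second component of a ring homomorphism into a trivial square-zero
extension whose first component is the algebra map. -/
noncomputable def derivationOfRingHom {A L M : Type*} [CommRing A] [CommRing L] [Algebra A L]
    [AddCommGroup M] [Module L M] [Module Lᵐᵒᵖ M] [IsCentralScalar L M] [Module A M]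
    [IsScalarTower A L M] (ψ : A →+* TrivSqZeroExt L M) (hψ : ∀ x, (ψ x).fst = algebraMap A L x) :
    Derivation ℤ A M :=
  Derivation.mk' ((sndHom L M).toAddMonoidHom.comp ψ.toAddMonoidHom).toIntLinearMap fun x y => by
    simp [snd_mul, hψ, algebraMap_smul]

@[simp]
theorem derivationOfRingHom_apply {A L M : Type*} [CommRing A] [CommRing L] [Algebra A L]
    [AddCommGroup M] [Module L M] [Module Lᵐᵒᵖ M] [IsCentralScalar L M] [Module A M]
    [IsScalarTower A L M] (ψ : A →+* TrivSqZeroExt L M) (hψ : ∀ x, (ψ x).fst = algebraMap A L x)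
    (x : A) : derivationOfRingHom ψ hψ x = (ψ x).snd := rfl

/-- The ring homomorphism `x ↦ x + ε D x` into a trivial square-zero extension. -/
noncomputable def ringHomOfDerivation {A L M : Type*} [CommRing A] [CommRing L] [Algebra A L]
    [AddCommGroup M] [Module L M] [Module Lᵐᵒᵖ M] [IsCentralScalar L M] [Module A M]
    [IsScalarTower A L M] (D : Derivation ℤ A M) : A →+* TrivSqZeroExt L M where
  toFun x := inl (algebraMap A L x) + inr (D x)
  map_one' := by simp
  map_zero' := by simp
  map_add' x y := by ext <;> simp
  map_mul' x y := by ext <;> simp [algebraMap_smul]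

@[simp]
theorem fst_ringHomOfDerivation {A L M : Type*} [CommRing A] [CommRing L] [Algebra A L]
    [AddCommGroup M] [Module L M] [Module Lᵐᵒᵖ M] [IsCentralScalar L M] [Module A M]
    [IsScalarTower A L M] (D : Derivation ℤ A M) (x : A) :
    (ringHomOfDerivation (L := L) D x).fst = algebraMap A L x := by
  simp [ringHomOfDerivation]

@[simp]
theorem snd_ringHomOfDerivation {A L M : Type*} [CommRing A] [CommRing L] [Algebra A L]
    [AddCommGroup M] [Module L M] [Module Lᵐᵒᵖ M] [IsCentralScalar L M] [Module A M]
    [IsScalarTower A L M] (D : Derivation ℤ A M) (x : A) :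
    (ringHomOfDerivation (L := L) D x).snd = D x := by
  simp [ringHomOfDerivation]

theorem inl_pow_eq_ringHomOfDerivation {A L M : Type*} [CommRing A] [CommRing L] [Algebra A L]
    [AddCommGroup M] [Module L M] [Module Lᵐᵒᵖ M] [IsCentralScalar L M] [Module A M]
    [IsScalarTower A L M] (D : Derivation ℤ A M) {x : A} {β : L} {n : ℕ}
    (hβ : β ^ n = algebraMap A L x) (hD : D x = 0) :
    (inl β : TrivSqZeroExt L M) ^ n = ringHomOfDerivation (L := L) D x := by
  rw [inl_pow, hβ]
  ext <;> simp [hD]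

theorem snd_pow_char {L M : Type*} [CommRing L] [AddCommGroup M] [Module L M]
    [Module Lᵐᵒᵖ M] [IsCentralScalar L M] (p : ℕ) [CharP L p] (t : TrivSqZeroExt L M) :
    (t ^ p).snd = 0 := by
  rw [snd_pow, ← Nat.cast_smul_eq_nsmul L, CharP.cast_eq_zero, zero_smul]

open IntermediateField in
/-- A derivation of `F` which does not vanish at a given `x` exists over any intermediate field not
containing `x`. -/
theorem exists_derivation_apply_eq_one_s14 {B F : Type*} [Field B] [Field F] [Algebra B F] {p : ℕ}
    [Fact p.Prime] [CharP F p] (hB : ∀ x : F, x ^ p ∈ Set.range (algebraMap B F))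
    (N₀ : IntermediateField B F) (x : F) (hx : x ∉ N₀) :
    ∃ D : Derivation ℤ F F, (∀ y ∈ N₀, D y = 0) ∧ D x = 1 := by
  obtain ⟨N, hN₀, hxN, htop⟩ := exists_intermediateField_adjoin_simple_eq_top hB N₀ x hx
  have : CharP N p := (algebraMap N F).charP (algebraMap N F).injective p
  obtain ⟨c, hc⟩ : ∃ c : N, x ^ p ^ 1 = algebraMap N F c := by
    obtain ⟨c, hc⟩ := hB x
    exact ⟨algebraMap B N c, by rw [pow_one, ← hc]; rfl⟩
  have hc' : ∀ y : N, y ^ p ≠ c := by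
    rintro y rfl
    have : x = y := frobenius_inj F p (by simpa [frobenius_def] using hc)
    exact hxN (this ▸ y.2)
  obtain ⟨ψ, hψ, hψN, hψx⟩ := exists_ringHom_adjoin_simple (T := TrivSqZeroExt F F)
    (fstHom F F F : TrivSqZeroExt F F →+* F) ((inlHom F F).comp (algebraMap N F))
    (fun _ => rfl) hc hc' (inl x + inr 1) (by simp) (by
      refine TrivSqZeroExt.ext ?_ ?_
      · simpa using hc
      · rw [pow_one, snd_pow_char]; simp)
  let e : F →+* N⟮x⟯ := (RingHom.id F).codRestrict N⟮x⟯ fun y => by rw [htop]; trivial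
  refine ⟨derivationOfRingHom (L := F) (ψ.comp e) fun y => hψ (e y), fun y hy => ?_, ?_⟩
  · have := congrArg snd (hψN ⟨y, hN₀ hy⟩)
    rw [RingHom.comp_apply, inlHom_apply, snd_inl] at this
    exact this
  · have := congrArg snd hψx
    rw [snd_add, snd_inl, snd_inr, zero_add] at this
    exact this

open IntermediateField in
/-- Ring homomorphisms lift along `F(βᵢ)/F`, `βᵢ ^ p ^ mᵢ = bᵢ`, when the `bᵢ` admit dual
derivations. -/
theorem exists_ringHom_adjoin_image {F L : Type} [Field F] [Field L] [Algebra F L] {p : ℕ}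
    [Fact p.Prime] [CharP F p] {ι : Type*} [DecidableEq ι] {b : ι → F} {m : ι → ℕ} {β : ι → L}
    (hβ : ∀ i, β i ^ p ^ m i = algebraMap F L (b i)) (δ : ι → Derivation ℤ F F)
    (hδ : ∀ i j, δ i (b j) = if i = j then 1 else 0) (s : Finset ι) :
    ∀ (T : Type) [CommRing T] (π : T →+* L) (φ : F →+* T) (_ : ∀ x, π (φ x) = algebraMap F L x)
      (_ : ∀ i ∈ s, ∃ y, π y = β i ∧ y ^ p ^ m i = φ (b i)),
      ∃ ψ : adjoin F (β '' s) →+* T, (∀ x, π (ψ x) = x) ∧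
        ∀ x, ψ (algebraMap F _ x) = φ x := by
  induction s using Finset.induction_on with
  | empty =>
    intro T _ π φ hφ _
    have hbot : adjoin F (β '' ((∅ : Finset ι) : Set ι)) = ⊥ := by simp
    rw [hbot]
    refine ⟨φ.comp (botEquiv F L : _ →+* F), fun x => ?_, fun x => ?_⟩
    · obtain ⟨y, rfl⟩ := (botEquiv F L).symm.surjective x
      simp [hφ]
    · simp
  | insert i s hi ih =>
    intro T _ π φ hφ hy
    set K := adjoin F (β '' s) with hK
    have : CharP L p := charP_of_injective_algebraMap (algebraMap F L).injective p
    have : CharP K p := charP_of_injective_algebraMap (algebraMap F K).injective p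
    have hnp : ∀ y : K, y ^ p ≠ algebraMap F K (b i) := by
      intro y hyb
      let D : Derivation ℤ F L := (Algebra.linearMap F L).compDer (δ i)
      obtain ⟨ψ, -, hψ⟩ := ih (TrivSqZeroExt L L) (fstHom L L L : TrivSqZeroExt L L →+* L)
        (ringHomOfDerivation (L := L) D) (fst_ringHomOfDerivation D) (fun j hj => ⟨inl (β j), rfl,
          inl_pow_eq_ringHomOfDerivation D (hβ j) (by
            have : i ≠ j := by rintro rfl; exact hi hj
            simp [D, hδ, this])⟩)
      have h1 := congrArg snd (hψ (b i))
      rw [← hyb, map_pow, snd_pow_char] at h1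
      simp [D, hδ] at h1
    obtain ⟨ψ, hψ, hψF⟩ := ih T π φ hφ fun j hj => hy j (by simp [hj])
    obtain ⟨y, hy1, hy2⟩ := hy i (by simp)
    obtain ⟨χ, hχ, hχK, -⟩ := exists_ringHom_adjoin_simple π ψ hψ
      (c := algebraMap F K (b i)) (by rw [hβ]; rfl) hnp y hy1 (by rw [hy2, hψF])
    have heq : adjoin F (β '' (insert i s : Finset ι)) = K⟮β i⟯.restrictScalars F := by
      rw [hK, adjoin_adjoin_left, Finset.coe_insert, Set.image_insert_eq, Set.union_singleton]
    rw [heq]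
    exact ⟨χ, hχ, fun x => by rw [← hψF, ← hχK]; rfl⟩

open IntermediateField in
theorem exists_derivation_adjoin {F L M : Type} [Field F] [Field L] [Algebra F L] {p : ℕ}
    [Fact p.Prime] [CharP F p] {ι : Type*} [Fintype ι] [DecidableEq ι] {b : ι → F} {m : ι → ℕ}
    {β : ι → L} (hβ : ∀ i, β i ^ p ^ m i = algebraMap F L (b i)) (δ : ι → Derivation ℤ F F)
    (hδ : ∀ i j, δ i (b j) = if i = j then 1 else 0)
    [AddCommGroup M] [Module L M] [Module Lᵐᵒᵖ M] [IsCentralScalar L M] [Module F M]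
    [IsScalarTower F L M] (D : Derivation ℤ F M) (hD : ∀ i, D (b i) = 0) :
    ∃ D' : Derivation ℤ (adjoin F (Set.range β)) M, ∀ x, D' (algebraMap F _ x) = D x := by
  have h := exists_ringHom_adjoin_image hβ δ hδ Finset.univ (TrivSqZeroExt L M)
    (fstHom L L M : TrivSqZeroExt L M →+* L) (ringHomOfDerivation (L := L) D) (fst_ringHomOfDerivation D)
    (fun i _ => ⟨inl (β i), rfl, inl_pow_eq_ringHomOfDerivation D (hβ i) (hD i)⟩)
  rw [Finset.coe_univ, Set.image_univ] at h
  obtain ⟨ψ, hψ, hψF⟩ := h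
  have hψ' : ∀ x, (ψ x).fst = algebraMap _ L x := hψ
  exact ⟨derivationOfRingHom (L := L) ψ hψ', fun x => by
    rw [derivationOfRingHom_apply, hψF, snd_ringHomOfDerivation]⟩

end Derivations

namespace ExteriorAlgebra

variable {R V ι' : Type*} [CommRing R] [AddCommGroup V] [Module R V]

theorem ι_mul_mul_eq_zero {v : V} {η : ExteriorAlgebra R V} (h : ι R v * η = 0)
    (ω : ExteriorAlgebra R V) : ι R v * ω * η = 0 := by
  induction ω using CliffordAlgebra.left_induction with
  | algebraMap r => rw [← Algebra.commutes, mul_assoc, h, mul_zero]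
  | add x y hx hy => rw [mul_add, add_mul, hx, hy, add_zero]
  | ι_mul x u hx =>
    change ι R v * (ι R u * x) * η = 0
    rw [← mul_assoc, eq_neg_of_add_eq_zero_left (ι_add_mul_swap v u), neg_mul, neg_mul, mul_assoc,
      mul_assoc, ← mul_assoc (ι R v), hx, mul_zero, neg_zero]

theorem contractRight_map_eq_zero (d : Module.Dual R V) (g : V →ₗ[R] V) (hd : d ∘ₗ g = 0)
    (ω : ExteriorAlgebra R V) :
    CliffordAlgebra.contractRight (Q := (0 : QuadraticForm R V)) (map g ω) d = 0 := by
  induction ω using CliffordAlgebra.right_induction with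
  | algebraMap r =>
    rw [AlgHom.commutes]
    exact CliffordAlgebra.contractRight_algebraMap _ d r
  | add x y hx hy => rw [map_add, map_add, LinearMap.add_apply, hx, hy, add_zero]
  | mul_ι m x hx =>
    change CliffordAlgebra.contractRight (Q := (0 : QuadraticForm R V)) (map g (x * ι R m)) d = 0
    rw [map_mul, map_apply_ι]
    refine (CliffordAlgebra.contractRight_mul_ι d _ _).trans ?_
    rw [hx, zero_mul, sub_zero, show d (g m) = 0 from DFunLike.congr_fun hd m, zero_smul]

theorem eq_zero_of_mul_prod_ι_eq_zero {k : ℕ} (e : Fin k → V) (d : Fin k → Module.Dual R V)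
    (hde : ∀ i j, d i (e j) = if i = j then 1 else 0) {η : ExteriorAlgebra R V}
    (hη : ∀ i, CliffordAlgebra.contractRight (Q := (0 : QuadraticForm R V)) η (d i) = 0)
    (h : η * (List.ofFn fun i => ι R (e i)).prod = 0) : η = 0 := by
  have hcontract : ∀ (d : Module.Dual R V) (l : List V), (∀ v ∈ l, d v = 0) →
      ∀ η : ExteriorAlgebra R V,
      CliffordAlgebra.contractRight (Q := (0 : QuadraticForm R V)) η d = 0 →
      CliffordAlgebra.contractRight (Q := (0 : QuadraticForm R V))
        (η * (l.map (ι R)).prod) d = 0 := by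
    intro d l
    induction l with
    | nil => simp
    | cons v l ih =>
      intro hl η hη
      rw [List.map_cons, List.prod_cons, ← mul_assoc]
      refine ih (fun w hw => hl w (by simp [hw])) _ ?_
      refine (CliffordAlgebra.contractRight_mul_ι d _ _).trans ?_
      rw [hη, zero_mul, sub_zero, hl v (by simp), zero_smul]
  induction k with
  | zero => simpa using h
  | succ k ih =>
    refine ih (fun i => e i.castSucc) (fun i => d i.castSucc) (fun i j => by simp [hde])
      (fun i => hη _) ?_
    have hofFn : (List.ofFn fun i : Fin k => ι R (e i.castSucc)) =
        (List.ofFn fun i : Fin k => e i.castSucc).map (ι R) := by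
      rw [List.map_ofFn]; rfl
    have h0 := hcontract (d (Fin.last k)) (List.ofFn fun i : Fin k => e i.castSucc) (by
      intro v hv
      obtain ⟨i, rfl⟩ := (List.mem_ofFn' _ _).1 hv
      simp [hde, (Fin.castSucc_lt_last i).ne']) η (hη _)
    rw [List.ofFn_succ', List.concat_eq_append, List.prod_append, List.prod_singleton,
      ← mul_assoc] at h
    have h1 := congrArg
      (fun x => CliffordAlgebra.contractRight (Q := (0 : QuadraticForm R V)) x (d (Fin.last k))) h
    simp only [map_zero, LinearMap.zero_apply] at h1
    rw [hofFn] at h1 ⊢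
    rw [← h1]
    refine Eq.symm ((CliffordAlgebra.contractRight_mul_ι _ _ _).trans ?_)
    rw [h0, zero_mul, sub_zero, hde, if_pos rfl, one_smul]

variable (R) in
/-- The degree `n` part of the left ideal `Σ eᵢ ∧ Λ`. -/
def wedgeSpan (e : ι' → V) : ℕ → Submodule R (ExteriorAlgebra R V)
  | 0 => ⊥
  | n + 1 => ⨆ i, (⋀[R]^n V).map (LinearMap.mulLeft R (ι R (e i)))

theorem ι_mul_mem_wedgeSpan (e : ι' → V) (i : ι') {n : ℕ} {w : ExteriorAlgebra R V}
    (hw : w ∈ ⋀[R]^n V) : ι R (e i) * w ∈ wedgeSpan R e (n + 1) :=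
  Submodule.mem_iSup_of_mem i ⟨w, hw, rfl⟩

theorem ι_mul_mem_exteriorPower (v : V) {n : ℕ} {w : ExteriorAlgebra R V}
    (hw : w ∈ ⋀[R]^n V) : ι R v * w ∈ ⋀[R]^(n + 1) V := by
  change _ ∈ LinearMap.range (ι R) ^ (n + 1)
  rw [pow_succ']
  exact Submodule.mul_mem_mul ⟨v, rfl⟩ hw

theorem wedgeSpan_le_exteriorPower (e : ι' → V) (n : ℕ) : wedgeSpan R e n ≤ ⋀[R]^n V := by
  cases n with
  | zero => exact bot_le
  | succ n =>
    refine iSup_le fun i => Submodule.map_le_iff_le_comap.2 fun w hw => ?_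
    exact ι_mul_mem_exteriorPower _ hw

theorem wedgeSpan_mul_eq_zero {k : ℕ} (e : Fin k → V) {n : ℕ} {w : ExteriorAlgebra R V}
    (hw : w ∈ wedgeSpan R e n) : w * (List.ofFn fun i => ι R (e i)).prod = 0 := by
  cases n with
  | zero => rw [(Submodule.mem_bot R).1 hw, zero_mul]
  | succ n =>
    have hle : wedgeSpan R e (n + 1) ≤
        LinearMap.ker (LinearMap.mulRight R (List.ofFn fun i => ι R (e i)).prod) := by
      refine iSup_le fun i => Submodule.map_le_iff_le_comap.2 fun x _ => ?_
      exact ι_mul_mul_eq_zero (ι_mul_prod_list e i) x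
    exact hle hw

theorem ι_mul_wedgeSpan_mem (e : ι' → V) (v : V) {n : ℕ} {w : ExteriorAlgebra R V}
    (hw : w ∈ wedgeSpan R e n) : ι R v * w ∈ wedgeSpan R e (n + 1) := by
  cases n with
  | zero => rw [(Submodule.mem_bot R).1 hw, mul_zero]; exact zero_mem _
  | succ n =>
    have hle : wedgeSpan R e (n + 1) ≤
        (wedgeSpan R e (n + 2)).comap (LinearMap.mulLeft R (ι R v)) := by
      refine iSup_le fun i => Submodule.map_le_iff_le_comap.2 fun x hx => ?_
      change ι R v * (ι R (e i) * x) ∈ wedgeSpan R e (n + 2)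
      rw [← mul_assoc, eq_neg_of_add_eq_zero_left (ι_add_mul_swap v (e i)), neg_mul, mul_assoc]
      exact neg_mem (ι_mul_mem_wedgeSpan e i (ι_mul_mem_exteriorPower v hx))
    exact hle hw

theorem sub_map_mem_wedgeSpan (e : ι' → V) (g : V →ₗ[R] V)
    (hg : ∀ v, v - g v ∈ Submodule.span R (Set.range e)) {n : ℕ} {ω : ExteriorAlgebra R V}
    (hω : ω ∈ ⋀[R]^n V) : ω - map g ω ∈ wedgeSpan R e n := by
  induction n generalizing ω with
  | zero =>
    change ω ∈ LinearMap.range (ι R) ^ 0 at hω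
    rw [pow_zero] at hω
    obtain ⟨r, rfl⟩ := Submodule.mem_one.1 hω
    rw [AlgHom.commutes, sub_self]
    exact zero_mem _
  | succ n ih =>
    change ω ∈ LinearMap.range (ι R) ^ (n + 1) at hω
    rw [pow_succ'] at hω
    induction hω using Submodule.mul_induction_on' with
    | mem_mul_mem a ha w hw =>
      obtain ⟨v, rfl⟩ := ha
      have hspan : Submodule.span R (Set.range e) ≤
          (wedgeSpan R e (n + 1)).comap ((LinearMap.mulRight R w).comp (ι R)) := by
        rw [Submodule.span_le]
        rintro _ ⟨i, rfl⟩
        exact ι_mul_mem_wedgeSpan e i hw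
      have h1 : ι R (v - g v) * w ∈ wedgeSpan R e (n + 1) := hspan (hg v)
      have h2 := add_mem h1 (ι_mul_wedgeSpan_mem e (g v) (ih hw))
      rw [map_sub, sub_mul, mul_sub, sub_add_sub_cancel] at h2
      rwa [map_mul, map_apply_ι]
    | add x _ y _ hx hy =>
      rw [map_add, add_sub_add_comm]
      exact add_mem hx hy

end ExteriorAlgebra

theorem notMem_adjoin_of_finrank_eq {B L : Type*} [Field B] [Field L] [Algebra B L] {p r : ℕ}
    (hp : 1 < p) (b : Fin r → L) (hb : ∀ i, b i ^ p ∈ Set.range (algebraMap B L))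
    (h : Module.finrank B (IntermediateField.adjoin B (Set.range b)) = p ^ r) (k : Fin r) :
    b k ∉ IntermediateField.adjoin B (b '' ({k}ᶜ : Finset (Fin r))) := by
  intro hk
  have heq : IntermediateField.adjoin B (Set.range b) =
      IntermediateField.adjoin B (b '' ({k}ᶜ : Finset (Fin r))) := by
    refine le_antisymm (IntermediateField.adjoin_le_iff.2 ?_)
      (IntermediateField.adjoin.mono _ _ _ (Set.image_subset_range _ _))
    rintro _ ⟨j, rfl⟩
    by_cases hj : j = k
    · exact hj ▸ hk
    · exact IntermediateField.subset_adjoin _ _ ⟨j, by simp [hj], rfl⟩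
  have hle := finrank_adjoin_image_le_pow (B := B) (by lia : 0 < p) b {k}ᶜ fun i _ => hb i
  rw [← heq, h, Finset.card_compl, Fintype.card_fin, Finset.card_singleton] at hle
  have := (Nat.pow_le_pow_iff_right hp).1 hle
  have := k.pos
  lia

section Restriction

theorem resMap_algebraMap (F E : Type) [Field F] [Field E] [Algebra F E] (c : F) :
    resMap F E (algebraMap F _ c) = algebraMap E _ (algebraMap F E c) := by
  unfold resMap
  let : Algebra F (ExtOmega E) :=
    ((algebraMap E (ExtOmega E)).comp (algebraMap F E)).toAlgebra'
      (fun c x => Algebra.commutes (algebraMap F E c) x)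
  exact AlgHom.commutes _ c

theorem resMap_ι (F E : Type) [Field F] [Field E] [Algebra F E] (v : Ω[F⁄ℤ]) :
    resMap F E (ι F v) = ι E (KaehlerDifferential.map ℤ ℤ F E v) := by
  unfold resMap
  let : Algebra F (ExtOmega E) :=
    ((algebraMap E (ExtOmega E)).comp (algebraMap F E)).toAlgebra'
      (fun c x => Algebra.commutes (algebraMap F E c) x)
  exact ExteriorAlgebra.lift_ι_apply _ _ _ v

open TensorProduct in
theorem baseChange_ι_mul_self {F A V : Type*} [Field F] [CommRing A] [Algebra F A] [AddCommGroup V]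
    [Module F V] (x : A ⊗[F] V) :
    (ι F : V →ₗ[F] ExteriorAlgebra F V).baseChange A x *
      (ι F : V →ₗ[F] ExteriorAlgebra F V).baseChange A x = 0 := by
  set j := (ι F : V →ₗ[F] ExteriorAlgebra F V).baseChange A
  have hanti : ∀ x y : A ⊗[F] V, j x * j y + j y * j x = 0 := by
    intro x y
    induction x using TensorProduct.induction_on with
    | zero => simp
    | add x x' hx hx' =>
      rw [map_add, add_mul, mul_add, add_add_add_comm, hx, hx', add_zero]
    | tmul a v =>
      induction y using TensorProduct.induction_on with
      | zero => simp
      | add y y' hy hy' =>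
        rw [map_add, add_mul, mul_add, add_add_add_comm, hy, hy', add_zero]
      | tmul a' v' =>
        simp only [j, LinearMap.baseChange_tmul, Algebra.TensorProduct.tmul_mul_tmul]
        rw [mul_comm a' a, ← TensorProduct.tmul_add, ι_add_mul_swap, TensorProduct.tmul_zero]
  induction x using TensorProduct.induction_on with
  | zero => simp
  | add x y hx hy =>
    rw [map_add, add_mul, mul_add, mul_add, hx, hy, zero_add, add_zero, hanti]
  | tmul a v =>
    simp only [j, LinearMap.baseChange_tmul, Algebra.TensorProduct.tmul_mul_tmul]
    rw [ι_sq_zero, TensorProduct.tmul_zero]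

open TensorProduct in
/-- If the derivation `x ↦ 1 ⊗ g (d x)` extends to `E`, then every form killed by restriction to `E`
is killed by the map induced by `g`. -/
theorem map_eq_zero_of_resMap_eq_zero {F L : Type} [Field F] [Field L] [Algebra F L]
    (E : IntermediateField F L) (g : Ω[F⁄ℤ] →ₗ[F] Ω[F⁄ℤ])
    (D : Derivation ℤ E (L ⊗[F] Ω[F⁄ℤ]))
    (hD : ∀ x, D (algebraMap F E x) = 1 ⊗ₜ g (KaehlerDifferential.D ℤ F x))
    {ω : ExtOmega F} (hω : resMap F E ω = 0) : ExteriorAlgebra.map g ω = 0 := by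
  let j := ((ι F : Ω[F⁄ℤ] →ₗ[F] ExtOmega F).baseChange L).restrictScalars E
  let H : ExtOmega E →ₐ[E] L ⊗[F] ExtOmega F :=
    ExteriorAlgebra.lift E ⟨j ∘ₗ D.liftKaehlerDifferential, fun v => baseChange_ι_mul_self _⟩
  have hmap : ∀ v, D.liftKaehlerDifferential (KaehlerDifferential.map ℤ ℤ F E v) = 1 ⊗ₜ g v := by
    intro v
    have hv : v ∈ Submodule.span F (Set.range (KaehlerDifferential.D ℤ F)) := by
      rw [KaehlerDifferential.span_range_derivation]; trivial
    induction hv using Submodule.span_induction with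
    | mem v hv =>
      obtain ⟨x, rfl⟩ := hv
      rw [KaehlerDifferential.map_D, Derivation.liftKaehlerDifferential_comp_D, hD]
    | zero => simp
    | add x y _ _ hx hy => rw [map_add, map_add, hx, hy, map_add, TensorProduct.tmul_add]
    | smul c x _ hx =>
      rw [map_smul, ← algebraMap_smul E c, map_smul, hx, map_smul]
      change (algebraMap F E c • (1 : L)) ⊗ₜ[F] g x = _
      rw [algebraMap_smul E c (1 : L), TensorProduct.smul_tmul]
  have hH : ∀ ω, H (resMap F E ω) = 1 ⊗ₜ ExteriorAlgebra.map g ω := by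
    intro ω
    induction ω using ExteriorAlgebra.induction with
    | algebraMap c =>
      rw [resMap_algebraMap, AlgHom.commutes, AlgHom.commutes,
        Algebra.algebraMap_eq_smul_one (A := L ⊗[F] ExtOmega F),
        Algebra.algebraMap_eq_smul_one (A := ExtOmega F), Algebra.TensorProduct.one_def]
      change (algebraMap F E c • (1 : L)) ⊗ₜ[F] (1 : ExtOmega F) = _
      rw [algebraMap_smul E c (1 : L), TensorProduct.smul_tmul]
    | ι v =>
      rw [resMap_ι, map_apply_ι]
      refine (ExteriorAlgebra.lift_ι_apply _ _ _ _).trans ?_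
      change (ι F : Ω[F⁄ℤ] →ₗ[F] ExtOmega F).baseChange L _ = _
      rw [hmap, LinearMap.baseChange_tmul]
    | mul x y hx hy =>
      rw [map_mul, map_mul, map_mul, hx, hy, Algebra.TensorProduct.tmul_mul_tmul, mul_one]
    | add x y hx hy => rw [map_add, map_add, map_add, hx, hy, TensorProduct.tmul_add]
  have h0 := hH ω
  rw [hω, map_zero] at h0
  exact Algebra.TensorProduct.includeRight_injective (A := L) (B := ExtOmega F)
    (algebraMap F L).injective (by simpa using h0.symm)

theorem resMap_dform_eq_zero {F : Type} [Field F] {p : ℕ} [CharP F p] {E : Type} [Field E] [Algebra F E] {a : F} {y : E} {m : ℕ}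
    (hm : 1 ≤ m) (hy : y ^ p ^ m = algebraMap F E a) : resMap F E (dform F a) = 0 := by
  have : CharP E p := charP_of_injective_algebraMap (algebraMap F E).injective p
  obtain ⟨k, rfl⟩ := Nat.exists_eq_add_of_le' hm
  rw [dform, resMap_ι, KaehlerDifferential.map_D, ← hy, Derivation.leibniz_pow,
    ← Nat.cast_smul_eq_nsmul E, Nat.cast_pow, CharP.cast_eq_zero, pow_succ, mul_zero, zero_smul,
    map_zero]

end Restriction

section PIndependence

variable {F : Type} [Field F] {p : ℕ} [Fact p.Prime] [CharP F p] {r : ℕ} {b : Fin r → F}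

theorem exists_dual_derivation_of_pIndep (hb : pIndep F p b) :
    ∃ δ : Fin r → Derivation ℤ F F, ∀ i j, δ i (b j) = if i = j then 1 else 0 := by
  have hB : ∀ x : F, x ^ p ∈ Set.range (algebraMap (pClosure F p ∅) F) := fun x =>
    ⟨⟨x ^ p, Subfield.subset_closure (.inl ⟨x, by simp⟩)⟩, rfl⟩
  have h : ∀ i, ∃ δ : Derivation ℤ F F, ∀ j, δ (b j) = if i = j then 1 else 0 := fun i => by
    obtain ⟨D, hD, hDi⟩ := exists_derivation_apply_eq_one_s14 hB _ _
      (notMem_adjoin_of_finrank_eq (Fact.out : p.Prime).one_lt b (fun i => hB (b i)) hb i)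
    refine ⟨D, fun j => ?_⟩
    split_ifs with hij
    · rw [← hij, hDi]
    · exact hD _ (IntermediateField.subset_adjoin _ _ ⟨j, by simpa [eq_comm] using hij, rfl⟩)
  choose δ hδ using h
  exact ⟨δ, hδ⟩

theorem iSup_wedgeL_eq_wedgeSpan (b : Fin r → F) (n : ℕ) :
    ⨆ i, wedgeL F (dform F (b i)) (OmegaPow F ((n : ℤ) - 1)) =
      wedgeSpan F (fun i => KaehlerDifferential.D ℤ F (b i)) n := by
  cases n with
  | zero => simp [OmegaPow, wedgeL, wedgeSpan]
  | succ n => simp [OmegaPow, wedgeL, wedgeSpan, dform]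

theorem mem_annOmega_singleton {n : ℕ} {η ω : ExtOmega F} :
    ω ∈ annOmega F n {η} ↔ ω ∈ ⋀[F]^n (Ω[F⁄ℤ]) ∧ ω * η = 0 := by
  simp [annOmega, OmegaPow]

theorem resMap_eq_zero_of_mem_wedgeSpan {E : Type} [Field E] [Algebra F E]
    (hb : ∀ i, resMap F E (dform F (b i)) = 0) {n : ℕ} {ω : ExtOmega F}
    (hω : ω ∈ wedgeSpan F (fun i => KaehlerDifferential.D ℤ F (b i)) n) : resMap F E ω = 0 := by
  cases n with
  | zero => rw [(Submodule.mem_bot F).1 hω, map_zero]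
  | succ n =>
    refine Submodule.iSup_induction _ (motive := fun ω => resMap F E ω = 0) hω ?_ (map_zero _)
      fun x y hx hy => by rw [map_add, hx, hy, add_zero]
    rintro i _ ⟨w, -, rfl⟩
    change resMap F E (dform F (b i) * w) = 0
    rw [map_mul, hb, zero_mul]

end PIndependence

/-- Proposition 5.3, first part. For a `p`-independent family
`{b₁,…,b_r} ⊆ F`, `m₁,…,m_r ≥ 1` and `E = F(b₁^{1/p^{m₁}}, …, b_r^{1/p^{m_r}})` inside an
algebraic closure of `F`:
`Ωⁿ(E/F) = Σᵢ d bᵢ ∧ Ω^{n−1}(F) = annΩ^n_F(d b₁ ∧ … ∧ d b_r)` and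
`ν_n(E/F) = ann ν^n_F(d b₁ ∧ … ∧ d b_r)`. -/
theorem stmt14 (F : Type) [Field F] (p : ℕ) [Fact p.Prime] [CharP F p]
    (n r : ℕ) (b : Fin r → F) (hb : pIndep F p b)
    (m : Fin r → ℕ) (hm : ∀ i, 1 ≤ m i)
    (β : Fin r → AlgebraicClosure F)
    (hβ : ∀ i, β i ^ p ^ m i = algebraMap F (AlgebraicClosure F) (b i)) :
    OmegaKer F (IntermediateField.adjoin F (Set.range β)) n =
        ((⨆ i, wedgeL F (dform F (b i)) (OmegaPow F ((n : ℤ) - 1)) :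
          Submodule F (ExtOmega F)) : Set (ExtOmega F)) ∧
      OmegaKer F (IntermediateField.adjoin F (Set.range β)) n =
        ((annOmega F n {dwedge F b} : Submodule F (ExtOmega F)) : Set (ExtOmega F)) ∧
      nuKer F (IntermediateField.adjoin F (Set.range β)) n =
        ((annNu F n {dwedge F b} : AddSubgroup (ExtOmega F)) : Set (ExtOmega F)) := by
  obtain ⟨δ, hδ⟩ := exists_dual_derivation_of_pIndep hb
  let e : Fin r → Ω[F⁄ℤ] := fun i => KaehlerDifferential.D ℤ F (b i)
  let d : Fin r → Module.Dual F (Ω[F⁄ℤ]) := fun i => (δ i).liftKaehlerDifferential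
  have hde : ∀ i j, d i (e j) = if i = j then 1 else 0 := fun i j => by
    rw [← hδ i j]; exact Derivation.liftKaehlerDifferential_comp_D _ _
  let g : Ω[F⁄ℤ] →ₗ[F] Ω[F⁄ℤ] := LinearMap.id - ∑ i, (d i).smulRight (e i)
  have hge : ∀ i, g (e i) = 0 := fun i => by simp [g, hde]
  have hdg : ∀ i, d i ∘ₗ g = 0 := fun i => by ext v; simp [g, hde]
  have hg : ∀ v, v - g v ∈ Submodule.span F (Set.range e) := fun v => by
    simp only [g, LinearMap.sub_apply, LinearMap.id_apply, sub_sub_cancel, LinearMap.sum_apply]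
    exact Submodule.sum_mem _ fun i _ =>
      Submodule.smul_mem _ _ (Submodule.subset_span ⟨i, rfl⟩)
  have hspan : ∀ {ω : ExtOmega F}, ω ∈ ⋀[F]^n (Ω[F⁄ℤ]) → map g ω = 0 → ω ∈ wedgeSpan F e n :=
    fun hω h => by simpa [h] using sub_map_mem_wedgeSpan e g hg hω
  have hker : OmegaKer F (IntermediateField.adjoin F (Set.range β)) n =
      (wedgeSpan F e n : Set (ExtOmega F)) := by
    ext ω
    constructor
    · rintro ⟨hω, h0⟩
      let D : Derivation ℤ F (TensorProduct F (AlgebraicClosure F) (Ω[F⁄ℤ])) :=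
        ((TensorProduct.mk F (AlgebraicClosure F) (Ω[F⁄ℤ]) 1).comp g).compDer
          (KaehlerDifferential.D ℤ F)
      obtain ⟨D', hD'⟩ := exists_derivation_adjoin hβ δ hδ D fun i => by
        change TensorProduct.tmul F (1 : AlgebraicClosure F) (g (e i)) = 0
        rw [hge, TensorProduct.tmul_zero]
      exact hspan (by simpa [OmegaPow] using hω) (map_eq_zero_of_resMap_eq_zero _ g D' hD' h0)
    · intro hω
      refine ⟨by simpa [OmegaPow] using wedgeSpan_le_exteriorPower e n hω,
        resMap_eq_zero_of_mem_wedgeSpan (fun i => ?_) hω⟩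
      exact resMap_dform_eq_zero (p := p) (m := m i) (hm i)
        (y := ⟨β i, IntermediateField.subset_adjoin _ _ ⟨i, rfl⟩⟩) (Subtype.ext (hβ i))
  have hann : OmegaKer F (IntermediateField.adjoin F (Set.range β)) n =
      (annOmega F n {dwedge F b} : Set (ExtOmega F)) := by
    rw [hker]
    ext ω
    rw [SetLike.mem_coe, SetLike.mem_coe, mem_annOmega_singleton]
    refine ⟨fun hω => ⟨wedgeSpan_le_exteriorPower e n hω, wedgeSpan_mul_eq_zero e hω⟩, ?_⟩
    rintro ⟨hω, h0⟩
    refine hspan hω (eq_zero_of_mul_prod_ι_eq_zero e d hde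
      (fun i => contractRight_map_eq_zero (d i) g (hdg i) ω) ?_)
    have h1 := wedgeSpan_mul_eq_zero e (sub_map_mem_wedgeSpan e g hg hω)
    rw [sub_mul] at h1
    exact (sub_eq_zero.1 h1).symm.trans h0
  refine ⟨by rw [hker, iSup_wedgeL_eq_wedgeSpan], hann, ?_⟩
  rw [nuKer, hann]
  rfl
end
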